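/- Let φ : R → S be a surjective homomorphism of commutative noetherian local rings with S of finite projective dimension over R. If S is a complete intersection ring, then R is a complete intersection ring and φ is a complete intersection map; conversely, if R is complete intersection and φ is a complete intersection map, then S is a complete intersection ring. -/

import Mathlib

/-!
STATEMENT 18: For a surjective homomorphism `φ : R → S` of commutative noetherian
local rings with `S` of finite projective dimension over `R`:
`S` is a complete intersection ring iff `R` is a complete intersection ring and
`φ` is a complete intersection map.

A noetherian local ring is *regular* iff its maximal ideal is generated by a
regular sequence; a noetherian local ring is *complete intersection* iff its
`m`-adic completion is the quotient of a regular local ring by an ideal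
generated by a regular sequence (Cohen presentation).
-/

/-- A surjective homomorphism of local rings is complete intersection if its kernel
is generated by a regular sequence. -/
def RingHom.IsCompleteIntersection {R S : Type} [CommRing R] [CommRing S]
    (φ : R →+* S) : Prop :=
  ∃ rs : List R, RingTheory.Sequence.IsRegular R rs ∧ Ideal.ofList rs = RingHom.ker φ

/-- A noetherian local ring is regular iff its maximal ideal is generated by a
regular sequence. -/
def IsRegularLocalRing' (Q : Type) [CommRing Q] [IsNoetherianRing Q]
    [IsLocalRing Q] : Prop :=
  ∃ ys : List Q, RingTheory.Sequence.IsRegular Q ys ∧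
    Ideal.ofList ys = IsLocalRing.maximalIdeal Q

/-- A noetherian local ring `S` is a complete intersection ring if its `m`-adic
completion admits a surjection from a regular local ring whose kernel is
generated by a regular sequence. -/
def IsCompleteIntersectionRing (S : Type) [CommRing S] [IsNoetherianRing S]
    [IsLocalRing S] : Prop :=
  ∃ (Q : Type) (_ : CommRing Q) (_ : IsNoetherianRing Q) (_ : IsLocalRing Q),
    IsRegularLocalRing' Q ∧
    ∃ f : Q →+* AdicCompletion (IsLocalRing.maximalIdeal S) S,
      Function.Surjective f ∧ f.IsCompleteIntersection

/-- Finite projective dimension via projective resolutions. -/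
def HasFiniteProjectiveDimension (R : Type) [Ring R] (M : Type)
    [AddCommGroup M] [Module R M] : Prop :=
  ∃ (n : ℕ) (P : ChainComplex (ModuleCat R) ℕ)
    (f : P ⟶ (ChainComplex.single₀ (ModuleCat R)).obj (ModuleCat.of R M)),
      QuasiIso f ∧ (∀ i, CategoryTheory.Projective (P.X i)) ∧
        ∀ i, n < i → CategoryTheory.Limits.IsZero (P.X i)




set_option linter.unusedSectionVars false

namespace CIAD
open Ideal IsLocalRing RingTheory.Sequence

section WR
variable {C : Type*} [CommRing C]

/-- elementwise weak regularity modulo an ideal -/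
def WR : Ideal C → List C → Prop
  | _, [] => True
  | c, t :: l => (∀ b, t * b ∈ c → b ∈ c) ∧ WR (c ⊔ span {t}) l

lemma WR_append (c : Ideal C) (l₁ l₂ : List C) :
    WR c (l₁ ++ l₂) ↔ WR c l₁ ∧ WR (c ⊔ ofList l₁) l₂ := by
  induction l₁ generalizing c with
  | nil => simp [WR]
  | cons t l ih =>
    simp only [List.cons_append, WR, ih, ofList_cons, sup_assoc, and_assoc]

lemma WR_singleton (c : Ideal C) (t : C) : WR c [t] ↔ ∀ b, t * b ∈ c → b ∈ c := by
  simp [WR]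

lemma smulRegular_quot_iff (c : Ideal C) (t : C) :
    IsSMulRegular (C ⧸ (c • ⊤ : Submodule C C)) t ↔ (∀ b, t * b ∈ c → b ∈ c) := by
  rw [isSMulRegular_iff_right_eq_zero_of_smul]
  constructor
  · intro h b hb
    have := h (Submodule.Quotient.mk b)
    rw [← Submodule.Quotient.mk_smul, Submodule.Quotient.mk_eq_zero,
      Submodule.Quotient.mk_eq_zero] at this
    simpa using this (by simpa using hb)
  · intro h x
    obtain ⟨b, rfl⟩ := Submodule.Quotient.mk_surjective _ x
    rw [← Submodule.Quotient.mk_smul, Submodule.Quotient.mk_eq_zero,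
      Submodule.Quotient.mk_eq_zero]
    simpa using h b

lemma isWeaklyRegular_iff_WR (l : List C) : IsWeaklyRegular C l ↔ WR ⊥ l := by
  induction l using List.reverseRecOn with
  | nil => simp [WR]
  | append_singleton l t ih =>
    rw [isWeaklyRegular_append_iff, WR_append, ih, isWeaklyRegular_singleton_iff,
      smulRegular_quot_iff, WR_singleton, bot_sup_eq]

lemma WR_comap {D : Type*} [CommRing D] (f : C →+* D) (hf : Function.Surjective f)
    (c : Ideal D) (l : List C) : WR (c.comap f) l ↔ WR c (l.map f) := by
  induction l generalizing c with
  | nil => simp [WR]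
  | cons t l ih =>
    simp only [WR, List.map_cons]
    have : c.comap f ⊔ span {t} = (c ⊔ span {f t}).comap f := by
      have e : c ⊔ span {f t} = (c.comap f ⊔ span {t}).map f := by
        rw [Ideal.map_sup, Ideal.map_comap_of_surjective f hf, Ideal.map_span, Set.image_singleton]
      rw [e, Ideal.comap_map_of_surjective f hf, eq_comm, sup_eq_left]
      exact le_sup_of_le_left (Ideal.comap_mono bot_le)
    rw [this, ih]
    refine and_congr_left fun _ => ?_
    constructor
    · intro h b hb
      obtain ⟨b, rfl⟩ := hf b
      simpa using h b (by simpa using hb)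
    · intro h b hb
      simpa using h (f b) (by simpa using hb)

lemma WR_ker {D : Type*} [CommRing D] (f : C →+* D) (hf : Function.Surjective f)
    (l : List C) : WR (RingHom.ker f) l ↔ WR ⊥ (l.map f) := by
  rw [← WR_comap f hf]; rfl

lemma ofList_le_iff {l : List C} {I : Ideal C} : ofList l ≤ I ↔ ∀ x ∈ l, x ∈ I :=
  Ideal.span_le

lemma mle {I J : Ideal C} (h : I ≤ J) {x : C} (hx : x ∈ I) : x ∈ J := h hx

lemma mem_ofList {l : List C} {x : C} (h : x ∈ l) : x ∈ ofList l := Ideal.subset_span h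

lemma ofList_perm {l l' : List C} (h : l.Perm l') : ofList l = ofList l' := by
  unfold ofList
  congr 1
  ext x
  exact h.mem_iff
end WR

section local_
variable {C : Type*} [CommRing C] [IsLocalRing C] 

local notation "𝔪" => maximalIdeal C

lemma isRegular_iff (l : List C) : IsRegular C l ↔ WR ⊥ l ∧ ofList l ≤ 𝔪 := by
  rw [RingTheory.Sequence.isRegular_iff, isWeaklyRegular_iff_WR]
  refine and_congr_right fun _ => ?_
  simp only [smul_eq_mul, mul_top]
  constructor
  · intro h
    exact IsLocalRing.le_maximalIdeal (Ne.symm h)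
  · intro h h'
    rw [← h'] at h
    exact (maximalIdeal.isMaximal C).ne_top (top_le_iff.1 h)

/-- local regular sequence -/
def RS (l : List C) : Prop := WR ⊥ l ∧ ofList l ≤ 𝔪

lemma RS.perm [IsNoetherianRing C] {l l' : List C} (h : RS l) (hp : l.Perm l') : RS l' := by
  rw [RS, ← isRegular_iff] at *
  exact IsLocalRing.isRegular_of_perm h hp

lemma pick (K : Ideal C) (hs : List C) (g : C) (hg : g ∈ K ⊔ ofList hs) :
    g ∈ K ⊔ 𝔪 * ofList hs ∨ ∃ h hs', hs.Perm (h :: hs') ∧ ∃ c : C, IsUnit c ∧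
      g - c * h ∈ K ⊔ ofList hs' := by
  induction hs generalizing g with
  | nil => left; simpa using hg
  | cons h t ih =>
    rw [ofList_cons, sup_left_comm] at hg
    obtain ⟨x, hx, y, hy, rfl⟩ := Submodule.mem_sup.1 hg
    obtain ⟨c, rfl⟩ := Ideal.mem_span_singleton'.1 hx
    by_cases hc : IsUnit c
    · right
      exact ⟨h, t, List.Perm.refl _, c, hc, by simpa using hy⟩
    · have hc : c ∈ 𝔪 := hc
      rcases ih y hy with h1 | ⟨h', t', hp, c', hc', h2⟩
      · left
        rw [ofList_cons, Ideal.mul_sup, sup_left_comm]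
        exact Submodule.add_mem_sup (Ideal.mul_mem_mul hc (Ideal.mem_span_singleton_self h)) h1
      · right
        refine ⟨h', h :: t', (hp.cons h).trans (List.Perm.swap _ _ _), c', hc', ?_⟩
        rw [add_sub_assoc, ofList_cons, sup_left_comm]
        exact Submodule.add_mem_sup hx h2

lemma WR_singleton_congr (K : Ideal C) (h g c : C) (hc : IsUnit c) (hg : g - c * h ∈ K)
    (hh : WR K [h]) : WR K [g] := by
  rw [WR_singleton] at *
  intro b hb
  apply hh
  have : c * (h * b) ∈ K := by
    have := K.sub_mem hb (K.mul_mem_right b hg)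
    convert this using 1; ring
  exact (Ideal.unit_mul_mem_iff_mem K hc).1 this

/-- exchange -/
lemma exchange [IsNoetherianRing C] (gs hs : List C) (g : C) (hr : RS (gs ++ hs))
    (hg : g ∈ ofList (gs ++ hs)) (hg' : g ∉ ofList gs ⊔ 𝔪 * ofList (gs ++ hs)) :
    ∃ hs', RS (gs ++ g :: hs') ∧ ofList (gs ++ g :: hs') = ofList (gs ++ hs) ∧
      hs'.length + 1 = hs.length := by
  rcases pick (ofList gs) hs g (by rwa [← ofList_append]) with h1 | ⟨h, hs', hp, c, hc, hd⟩
  · exact absurd ((sup_le_sup_left (Ideal.mul_mono_right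
      (by rw [ofList_append]; exact le_sup_right)) (ofList gs)) h1) hg'
  · have hp1 : (gs ++ hs).Perm ((gs ++ hs') ++ [h]) := by
      refine ((hp.append_left gs)).trans ?_
      rw [List.append_assoc]
      exact (List.perm_append_singleton h hs').symm.append_left gs
    have hr1 := hr.perm hp1
    have hJ : ofList ((gs ++ hs') ++ [g]) = ofList (gs ++ hs) := by
      rw [ofList_perm hp1]
      simp only [ofList_append, ofList_singleton] at hd ⊢
      apply le_antisymm
      · refine sup_le le_sup_left ?_
        rw [Ideal.span_singleton_le_iff_mem]
        have := Submodule.add_mem_sup hd (Ideal.mul_mem_left _ c (Ideal.mem_span_singleton_self h))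
        simpa using this
      · refine sup_le le_sup_left ?_
        rw [Ideal.span_singleton_le_iff_mem, ← Ideal.unit_mul_mem_iff_mem _ hc]
        have := Ideal.sub_mem _ (Ideal.mem_sup_right (Ideal.mem_span_singleton_self g) :
          g ∈ ofList gs ⊔ ofList hs' ⊔ span {g}) (Ideal.mem_sup_left hd)
        simpa using this
    have hr2 : RS ((gs ++ hs') ++ [g]) := by
      refine ⟨?_, hJ ▸ hr.2⟩
      have := hr1.1
      rw [WR_append] at this ⊢
      refine ⟨this.1, WR_singleton_congr _ h g c hc ?_ this.2⟩
      simpa using hd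
    have hp2 : ((gs ++ hs') ++ [g]).Perm (gs ++ g :: hs') := by
      rw [List.append_assoc]
      exact (List.perm_append_singleton g hs').append_left gs
    exact ⟨hs', hr2.perm hp2, (ofList_perm hp2).symm.trans hJ, by simpa using hp.length_eq.symm⟩

lemma split [IsNoetherianRing C] (a : Ideal C) (gs hs : List C) (hr : RS (gs ++ hs))
    (hgs : ofList gs ≤ a) (ha : a ≤ ofList (gs ++ hs)) (hm : a ⊓ 𝔪 * ofList (gs ++ hs) ≤ 𝔪 * a) :
    ∃ gs' hs', RS (gs' ++ hs') ∧ ofList gs' = a ∧ ofList (gs' ++ hs') = ofList (gs ++ hs) := by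
  induction hn : hs.length generalizing gs hs with
  | zero =>
    obtain rfl := List.length_eq_zero_iff.1 hn
    exact ⟨gs, [], hr, le_antisymm hgs (by simpa using ha), rfl⟩
  | succ n ih =>
    by_cases h : a ≤ ofList gs ⊔ 𝔪 * ofList (gs ++ hs)
    · refine ⟨gs, hs, hr, le_antisymm hgs ?_, rfl⟩
      have h2 : a ≤ ofList gs ⊔ 𝔪 • a := by
        intro x hx
        obtain ⟨y, hy, z, hz, rfl⟩ := Submodule.mem_sup.1 (h hx)
        refine Submodule.add_mem_sup hy (hm ⟨?_, hz⟩)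
        simpa using a.sub_mem hx (hgs hy)
      exact Submodule.le_of_le_smul_of_le_jacobson_bot (IsNoetherian.noetherian a)
        (IsLocalRing.maximalIdeal_le_jacobson _) h2
    · obtain ⟨g, hga, hg⟩ := SetLike.not_le_iff_exists.1 h
      obtain ⟨hs', h1, h2, h3⟩ := exchange gs hs g hr (ha hga) hg
      have e : gs ++ g :: hs' = (gs ++ [g]) ++ hs' := by simp
      rw [e] at h1 h2
      rw [← h2] at ha hm ⊢
      refine ih (gs ++ [g]) hs' h1 ?_ ha hm (by omega)
      rw [ofList_append, ofList_singleton]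
      exact sup_le hgs ((Ideal.span_singleton_le_iff_mem _).2 hga)

lemma sup_pow_le (a b : Ideal C) (n : ℕ) : (a ⊔ b) ^ (n + 1) ≤ a * (a ⊔ b) ^ n ⊔ b ^ (n + 1) := by
  induction n with
  | zero => simp
  | succ n ih =>
    calc (a ⊔ b) ^ (n + 1 + 1) = a * (a ⊔ b) ^ (n + 1) ⊔ b * (a ⊔ b) ^ (n + 1) := by
          rw [pow_succ' _ (n + 1), Ideal.sup_mul]
      _ ≤ a * (a ⊔ b) ^ (n + 1) ⊔ b * (a * (a ⊔ b) ^ n ⊔ b ^ (n + 1)) :=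
          sup_le_sup_left (Ideal.mul_mono_right ih) _
      _ ≤ _ := by
          rw [Ideal.mul_sup, ← pow_succ' b]
          refine sup_le le_sup_left (sup_le (le_sup_of_le_left ?_) le_sup_right)
          rw [pow_succ' (a ⊔ b), mul_left_comm]
          exact Ideal.mul_mono_right (Ideal.mul_mono_left le_sup_right)

lemma RS.prefix {l l' : List C} (h : RS (l ++ l')) : RS l :=
  ⟨((WR_append _ _ _).1 h.1).1, le_trans (by rw [ofList_append]; exact le_sup_left) h.2⟩

lemma RS.mem_of_mul_mem {l l' : List C} {t b : C} (h : RS (l ++ t :: l')) (hb : t * b ∈ ofList l) :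
    b ∈ ofList l := by
  have := ((WR_append _ _ _).1 h.1).2.1 b
  simp only [bot_sup_eq] at this
  exact this hb

lemma nzd_pow [IsNoetherianRing C] (ys ts : List C) (t : C) (h : RS (ts ++ t :: ys)) (j : ℕ) (b : C)
    (hb : t * b ∈ ofList ts ⊔ (ofList ys) ^ j) : b ∈ ofList ts ⊔ (ofList ys) ^ j := by
  induction ys generalizing ts t j b with
  | nil =>
    cases j with
    | zero => simp
    | succ j =>
      simp only [ofList_nil, bot_pow (Nat.succ_ne_zero j), sup_bot_eq] at hb ⊢
      exact h.mem_of_mul_mem hb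
  | cons y ys' ih =>
    have ih1 := ih (ts ++ [t]) y (by simpa using h)
    have ih2 := ih ts t (by
      have : RS ((ts ++ t :: ys') ++ [y]) := by
        refine h.perm ?_
        rw [List.append_assoc]
        refine List.Perm.append_left ts ?_
        exact (List.Perm.cons t (List.perm_append_singleton y ys').symm)
      exact this.prefix)
    induction j generalizing b with
    | zero => simp
    | succ j ihj =>
      rw [ofList_append, ofList_singleton] at ih1
      have hle : ofList ys' ≤ ofList (y :: ys') := by rw [ofList_cons]; exact le_sup_right
      have h1 : t * b ∈ ofList ts ⊔ (span {y} * (ofList (y :: ys')) ^ j ⊔ (ofList ys') ^ (j + 1)) := by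
        refine mle (sup_le_sup_left ?_ _) hb
        rw [ofList_cons]
        exact sup_pow_le _ _ _
      obtain ⟨τ, hτ, z, hz, hτz⟩ := Submodule.mem_sup.1 h1
      obtain ⟨yu, hyu, v, hv, rfl⟩ := Submodule.mem_sup.1 hz
      obtain ⟨u, hu, rfl⟩ := Ideal.mem_span_singleton_mul.1 hyu
      have h2 : y * u ∈ ofList ts ⊔ span {t} ⊔ (ofList ys') ^ (j + 1) := by
        have e : y * u = (-τ + t * b) + (-v) := by rw [← hτz]; ring
        rw [e]
        refine Submodule.add_mem_sup (Submodule.add_mem_sup ((ofList ts).neg_mem hτ) ?_)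
          (Ideal.neg_mem_iff _ |>.2 hv)
        exact Ideal.mul_mem_right _ _ (Ideal.mem_span_singleton_self t)
      obtain ⟨q, hq, u', hu', hqu⟩ := Submodule.mem_sup.1 (ih1 _ _ h2)
      obtain ⟨τ', hτ', tw, htw, rfl⟩ := Submodule.mem_sup.1 hq
      obtain ⟨w, rfl⟩ := Ideal.mem_span_singleton.1 htw
      have h3 : b - y * w ∈ ofList ts ⊔ (ofList ys') ^ (j + 1) := by
        apply ih2
        have e : t * (b - y * w) = (τ + y * τ') + (y * u' + v) := by
          have : t * b = τ + (y * u + v) := hτz.symm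
          rw [mul_sub, this, ← hqu]; ring
        rw [e]
        exact Submodule.add_mem_sup (Ideal.add_mem _ hτ (Ideal.mul_mem_left _ _ hτ'))
          (Ideal.add_mem _ (Ideal.mul_mem_left _ _ hu') hv)
      have h4 : w ∈ ofList ts ⊔ (ofList (y :: ys')) ^ j := by
        apply ihj
        have e : t * w = -τ' + (u - u') := by rw [← hqu]; ring
        rw [e]
        exact Submodule.add_mem_sup ((ofList ts).neg_mem hτ')
          (Ideal.sub_mem _ hu (Ideal.pow_right_mono hle _ (Ideal.pow_le_pow_right (Nat.le_succ j) hu')))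
      have h5 : y * w ∈ ofList ts ⊔ (ofList (y :: ys')) ^ (j + 1) := by
        have : y * w ∈ ofList (y :: ys') * (ofList ts ⊔ (ofList (y :: ys')) ^ j) :=
          Ideal.mul_mem_mul (mem_ofList (by simp)) h4
        rw [Ideal.mul_sup, ← pow_succ'] at this
        exact mle (sup_le_sup_right Ideal.mul_le_right _) this
      have := Ideal.add_mem _ (mle (sup_le_sup_left (Ideal.pow_right_mono hle (j + 1)) (ofList ts)) h3) h5
      simpa using this

/-- chains of elements independent modulo `c ⊔ 𝔪 ^ 2` -/
def Chain (c : Ideal C) : List C → Prop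
  | [] => True
  | y :: l => Chain c l ∧ y ∈ 𝔪 ∧ y ∉ c ⊔ ofList l ⊔ 𝔪 ^ 2

/-- graded regularity -/
def GG (c : Ideal C) : Prop := ∀ y l, Chain c (y :: l) → ∀ k b,
  y * b ∈ c ⊔ ofList l ⊔ 𝔪 ^ (k + 1) → b ∈ c ⊔ ofList l ⊔ 𝔪 ^ k

lemma Chain.extend [IsNoetherianRing C] {ys l : List C} (h : RS ys) (hm : ofList ys = 𝔪)
    (hc : Chain ⊥ l) : ∃ hs, RS (l ++ hs) ∧ ofList (l ++ hs) = 𝔪 := by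
  induction l with
  | nil => exact ⟨ys, h, hm⟩
  | cons y l ih =>
    obtain ⟨hs, h1, h2⟩ := ih hc.1
    obtain ⟨hs', h3, h4, -⟩ := exchange l hs y h1 (h2 ▸ hc.2.1) (by
      have := hc.2.2
      rwa [h2, ← pow_two, ← bot_sup_eq (ofList l)])
    have hp : (l ++ y :: hs').Perm ((y :: l) ++ hs') := List.perm_middle
    exact ⟨hs', h3.perm hp, by rw [← ofList_perm hp, h4, h2]⟩

lemma GG_bot [IsNoetherianRing C] {ys : List C} (h : RS ys) (hm : ofList ys = 𝔪) :
    GG (⊥ : Ideal C) := by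
  intro y l hc k b hb
  rw [bot_sup_eq] at *
  obtain ⟨hs, h1, h2⟩ := Chain.extend h hm hc
  have hp : ((y :: l) ++ hs).Perm (l ++ y :: hs) := List.perm_middle.symm
  have h1 := h1.perm hp
  rw [ofList_perm hp] at h2
  have hH : ofList hs ≤ 𝔪 := by
    rw [← h2, ofList_append, ofList_cons]; exact le_sup_of_le_right le_sup_right
  have hle : 𝔪 ^ (k + 1) ≤ ofList l ⊔ (span {y} * 𝔪 ^ k ⊔ (ofList hs) ^ (k + 1)) := by
    have : 𝔪 = ofList l ⊔ ofList (y :: hs) := by rw [← h2, ofList_append]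
    calc 𝔪 ^ (k + 1) = (ofList l ⊔ ofList (y :: hs)) ^ (k + 1) := by rw [← this]
      _ ≤ _ := sup_pow_le _ _ _
      _ ≤ _ := by
        refine sup_le_sup Ideal.mul_le_left ?_
        rw [ofList_cons]
        refine (sup_pow_le _ _ _).trans (sup_le_sup_right (Ideal.mul_mono_right ?_) _)
        refine Ideal.pow_right_mono ?_ k
        rw [this, ofList_cons]; exact le_sup_right
  have hb' := (sup_le le_sup_left hle) hb
  obtain ⟨τ, hτ, z, hz, hτz⟩ := Submodule.mem_sup.1 hb'
  obtain ⟨yu, hyu, v, hv, rfl⟩ := Submodule.mem_sup.1 hz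
  obtain ⟨u, hu, rfl⟩ := Ideal.mem_span_singleton_mul.1 hyu
  have h3 : b - u ∈ ofList l ⊔ (ofList hs) ^ (k + 1) := by
    apply nzd_pow hs l y h1
    have e : y * (b - u) = τ + v := by
      have : y * b = τ + (y * u + v) := hτz.symm
      rw [mul_sub, this]; ring
    rw [e]
    exact Submodule.add_mem_sup hτ hv
  have h4 : b - u ∈ ofList l ⊔ 𝔪 ^ k :=
    mle (sup_le_sup_left ((Ideal.pow_right_mono hH _).trans (Ideal.pow_le_pow_right (Nat.le_succ k))) _) h3
  simpa using Ideal.add_mem _ h4 (Ideal.mem_sup_right hu)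

section descent
variable {D : Type*} [CommRing D] [Algebra C D] [Module.FaithfullyFlat C D]

lemma WR_descent (c : Ideal C) (l : List C)
    (h : WR (c.map (algebraMap C D)) (l.map (algebraMap C D))) : WR c l := by
  induction l generalizing c with
  | nil => simp [WR]
  | cons t l ih =>
    simp only [WR, List.map_cons] at h ⊢
    refine ⟨fun b hb => ?_, ih _ ?_⟩
    · have := h.1 (algebraMap C D b) (by rw [← map_mul]; exact Ideal.mem_map_of_mem _ hb)
      rwa [← Ideal.mem_comap, Ideal.comap_map_eq_self_of_faithfullyFlat] at this
    · rw [Ideal.map_sup, Ideal.map_span, Set.image_singleton]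
      exact h.2

lemma descent [IsNoetherianRing C] [IsNoetherianRing D] [IsLocalRing D]
    (hmm : (𝔪).map (algebraMap C D) = maximalIdeal D)
    (I : Ideal C) (gs : List C) (hs : List D) (hr : RS (gs.map (algebraMap C D) ++ hs))
    (hI : ofList (gs.map (algebraMap C D) ++ hs) = I.map (algebraMap C D))
    (hgs : ofList gs ≤ I) : ∃ gs' : List C, RS gs' ∧ ofList gs' = I := by
  have done : ∀ gs : List C, RS (gs.map (algebraMap C D)) → RS gs := by
    intro gs h
    refine ⟨WR_descent (D := D) _ _ (by simpa using h.1), ?_⟩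
    have := h.2
    rw [← hmm, ← Ideal.map_ofList] at this
    have := Ideal.comap_mono (f := algebraMap C D) this
    rwa [Ideal.comap_map_eq_self_of_faithfullyFlat, Ideal.comap_map_eq_self_of_faithfullyFlat] at this
  induction hn : hs.length generalizing gs hs with
  | zero =>
    obtain rfl := List.length_eq_zero_iff.1 hn
    rw [List.append_nil] at *
    refine ⟨gs, done _ hr, ?_⟩
    rw [← Ideal.comap_map_eq_self_of_faithfullyFlat (B := D) (ofList gs), Ideal.map_ofList, hI,
      Ideal.comap_map_eq_self_of_faithfullyFlat]
  | succ n ih =>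
    by_cases h : I ≤ ofList gs ⊔ 𝔪 • I
    · exact ⟨gs, done _ hr.prefix, le_antisymm hgs <|
        Submodule.le_of_le_smul_of_le_jacobson_bot (IsNoetherian.noetherian I)
          (IsLocalRing.maximalIdeal_le_jacobson _) h⟩
    · obtain ⟨g, hga, hg⟩ := SetLike.not_le_iff_exists.1 h
      obtain ⟨hs', h1, h2, h3⟩ := exchange (gs.map (algebraMap C D)) hs (algebraMap C D g) hr
        (hI ▸ Ideal.mem_map_of_mem _ hga) (by
          rw [hI, ← hmm, ← Ideal.map_ofList, ← Ideal.map_mul, ← Ideal.map_sup, ← Ideal.mem_comap,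
            Ideal.comap_map_eq_self_of_faithfullyFlat]
          exact hg)
      have e : gs.map (algebraMap C D) ++ algebraMap C D g :: hs' =
        (gs ++ [g]).map (algebraMap C D) ++ hs' := by simp
      rw [e] at h1 h2
      refine ih (gs ++ [g]) hs' h1 (h2.trans hI) ?_ (by omega)
      rw [ofList_append, ofList_singleton]
      exact sup_le hgs ((Ideal.span_singleton_le_iff_mem _).2 hga)

end descent

end local_
end CIAD




set_option linter.unusedSectionVars false

namespace CIAD
open Ideal IsLocalRing RingTheory.Sequence

section FR

/-- existence of a finite minimal free resolution of a submodule of a finite free module -/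
def FR (R : Type*) [CommRing R] [IsLocalRing R] : ℕ → ∀ b : ℕ, Submodule R (Fin b → R) → Prop
  | 0, b, _ => b = 0
  | n + 1, b, U => b = 0 ∨ ∃ (b' : ℕ) (d : Matrix (Fin b) (Fin b') R),
      (∀ i j, d i j ∈ maximalIdeal R) ∧ LinearMap.range d.mulVecLin = U ∧
        FR R n b' (LinearMap.ker d.mulVecLin)

variable {P R : Type*} [CommRing P] [CommRing R] [IsLocalRing P] [IsLocalRing R]

/-- `f` has a matrix square root with entries in `m` and a row in `J`. -/
def MF (J : Ideal P) (f : P) : Prop :=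
  ∃ (ι : Type) (_ : Fintype ι) (_ : DecidableEq ι) (i0 : ι) (D : Matrix ι ι P),
    D * D = f • (1 : Matrix ι ι P) ∧ (∀ i j, D i j ∈ maximalIdeal P) ∧ ∀ j, D i0 j ∈ J

lemma MF_of_mem (J : Ideal P) (hJ : J ≤ maximalIdeal P) (f : P) (hf : f ∈ maximalIdeal P * J) :
    MF J f := by
  suffices h : ∀ g, MF J g → MF J (g + f) by
    have := h 0 ⟨Unit, inferInstance, inferInstance, (), 0, by simp, by simp, by simp⟩
    simpa using this
  refine Submodule.mul_induction_on (C := fun f => ∀ g, MF J g → MF J (g + f)) hf ?_ ?_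
  · rintro x hx h hh g ⟨ι, _, _, i0, D, h1, h2, h3⟩
    refine ⟨ι ⊕ ι, inferInstance, inferInstance, Sum.inl i0,
      Matrix.fromBlocks D (h • 1) (x • 1) (-D), ?_, ?_, ?_⟩
    · rw [Matrix.fromBlocks_multiply, ← Matrix.fromBlocks_one, Matrix.fromBlocks_smul]
      congr 1
      · simp [h1, add_smul, smul_smul]
      · simp
      · simp
      · simp [h1, add_smul, smul_smul, mul_comm, add_comm]
    · have hx1 : ∀ i j, (x • (1 : Matrix ι ι P)) i j ∈ maximalIdeal P := fun i j =>
        Ideal.mul_mem_right _ _ hx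
      have hh1 : ∀ i j, (h • (1 : Matrix ι ι P)) i j ∈ maximalIdeal P := fun i j =>
        Ideal.mul_mem_right _ _ (hJ hh)
      rintro (i | i) (j | j)
      · exact h2 i j
      · exact hh1 i j
      · exact hx1 i j
      · exact neg_mem (h2 i j)
    · rintro (j | j)
      · exact h3 j
      · exact Ideal.mul_mem_right _ _ hh
  · intro x y hx hy g hg
    rw [← add_assoc]
    exact hy _ (hx _ hg)

lemma mul_entry_mem {ι κ μ : Type*} [Fintype κ] (I J : Ideal P) (A : Matrix ι κ P)
    (B : Matrix κ μ P) (hA : ∀ i j, A i j ∈ I) (hB : ∀ i j, B i j ∈ J) (i : ι) (j : μ) :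
    (A * B) i j ∈ I * J := by
  rw [Matrix.mul_apply]
  exact Ideal.sum_mem _ fun k _ => Ideal.mul_mem_mul (hA i k) (hB k j)

lemma lift_cols (π : P →+* R) (hπ : Function.Surjective π) [IsLocalHom π] {ι : Type*} {b b' : ℕ}
    (d : Matrix (Fin b) (Fin b') R) (hd : ∀ i j, d i j ∈ maximalIdeal R)
    (X : Matrix (Fin b) ι P) (hX : ∀ j, (fun i => π (X i j)) ∈ LinearMap.range d.mulVecLin) :
    ∃ (d' : Matrix (Fin b) (Fin b') P) (Y : Matrix (Fin b') ι P),
      (∀ i j, d' i j ∈ maximalIdeal P) ∧ d'.map π = d ∧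
      ∀ i j, (d' * Y - X) i j ∈ RingHom.ker π := by
  choose s hs using hπ
  choose v hv using hX
  refine ⟨d.map s, Matrix.of fun i j => s (v j i), ?_, ?_, ?_⟩
  · intro i j
    have h := hd i j
    rw [mem_maximalIdeal, mem_nonunits_iff] at h ⊢
    intro hu
    apply h
    have := hu.map π
    rwa [Matrix.map_apply, hs] at this
  · ext i j; simp [hs]
  · intro i j
    have := congrFun (hv j) i
    simp only [Matrix.mulVecLin_apply, Matrix.mulVec, dotProduct] at this
    rw [RingHom.mem_ker, Matrix.sub_apply, map_sub, ← this, Matrix.mul_apply, map_sum]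
    simp [hs]

lemma step_ker (π : P →+* R) {ι : Type*} [Fintype ι] [DecidableEq ι] {b b' : ℕ} (f : P)
    (hf : f ∈ RingHom.ker π) (D : Matrix ι ι P) (hD : D * D = f • (1 : Matrix ι ι P))
    (d : Matrix (Fin b) (Fin b') P) (X : Matrix (Fin b) ι P) (Y : Matrix (Fin b') ι P)
    (h : ∀ i j, (d * Y - X * D) i j ∈ RingHom.ker π) (j : ι) :
    (fun i => π ((Y * D) i j)) ∈ LinearMap.ker (d.map π).mulVecLin := by
  rw [LinearMap.mem_ker, Matrix.mulVecLin_apply]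
  ext i
  have e : d * (Y * D) = (d * Y - X * D) * D + f • X := by
    rw [Matrix.sub_mul, Matrix.mul_assoc X, hD]; simp [Matrix.mul_assoc]
  have : π ((d * (Y * D)) i j) = 0 := by
    rw [e, Matrix.add_apply, map_add, Matrix.mul_apply, map_sum, Matrix.smul_apply, smul_eq_mul,
      map_mul, (RingHom.mem_ker).1 hf, zero_mul, add_zero]
    refine Finset.sum_eq_zero fun k _ => ?_
    rw [map_mul, (RingHom.mem_ker).1 (h i k), zero_mul]
  rw [Matrix.mul_apply, map_sum] at this
  simpa [Matrix.mulVec, dotProduct] using this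

lemma key_claim (π : P →+* R) (hπ : Function.Surjective π) [IsLocalHom π] {ι : Type*} [Fintype ι]
    [DecidableEq ι] (f : P) (hf : f ∈ RingHom.ker π)
    (hf' : f ∉ maximalIdeal P * RingHom.ker π) (D : Matrix ι ι P)
    (hD : D * D = f • (1 : Matrix ι ι P)) (hDm : ∀ i j, D i j ∈ maximalIdeal P)
    (n : ℕ) : ∀ (b : ℕ) (U : Submodule R (Fin b → R)) (_ : FR R n b U) (X : Matrix (Fin b) ι P)
    (_ : ∀ j, (fun i => π ((X * D) i j)) ∈ U), ∀ i j, X i j ∈ maximalIdeal P := by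
  induction n using Nat.strong_induction_on with
  | _ n ih =>
  intro b U hU X hX i j
  suffices h : f * X i j ∈ maximalIdeal P * RingHom.ker π by
    by_contra hu
    have hu : IsUnit (X i j) := by simpa using hu
    exact hf' ((Ideal.mul_unit_mem_iff_mem _ hu).1 h)
  rcases Nat.eq_zero_or_pos b with rfl | hb
  · exact i.elim0
  obtain _ | n := n
  · exact absurd hU hb.ne'
  obtain ⟨b', d, hdm, rfl, hFR⟩ := hU.resolve_left hb.ne'
  obtain ⟨d, Y, hdm', rfl, hY⟩ := lift_cols π hπ d hdm (X * D) hX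
  have hYD := step_ker π f hf D hD d X Y hY
  have e : d * (Y * D) = (d * Y - X * D) * D + f • X := by
    rw [Matrix.sub_mul, Matrix.mul_assoc X, hD]; simp [Matrix.mul_assoc]
  have h1 : ((d * Y - X * D) * D) i j ∈ maximalIdeal P * RingHom.ker π := by
    rw [mul_comm]; exact mul_entry_mem _ _ _ _ hY hDm i j
  have e2 : f * X i j = (d * (Y * D)) i j - ((d * Y - X * D) * D) i j := by
    rw [e]; simp
  rw [e2]
  refine Ideal.sub_mem _ ?_ h1
  rcases Nat.eq_zero_or_pos b' with rfl | hb'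
  · simp [Matrix.mul_apply]
  obtain _ | n := n
  · exact absurd hFR hb'.ne'
  obtain ⟨b'', d', hdm'', hr, hFR'⟩ := hFR.resolve_left hb'.ne'
  rw [← hr] at hYD
  obtain ⟨d', Z, hdm3, rfl, hZ⟩ := lift_cols π hπ d' hdm'' (Y * D) hYD
  have hZD := step_ker π f hf D hD d' Y Z hZ
  have hZm := ih n (by omega) b'' _ hFR' Z hZD
  have hdd : ∀ i j, (d * d') i j ∈ RingHom.ker π := by
    intro i j
    have h0 : (d'.map π).mulVecLin (Pi.single j 1) ∈ LinearMap.ker (d.map π).mulVecLin := by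
      rw [← hr]; exact ⟨_, rfl⟩
    have h2 := congrFun (LinearMap.mem_ker.1 h0) i
    rw [Matrix.mulVecLin_apply, Matrix.mulVecLin_apply, Matrix.mulVec_single_one] at h2
    rw [RingHom.mem_ker, Matrix.mul_apply, map_sum]
    simpa [Matrix.mulVec, dotProduct] using h2
  have e3 : d * (Y * D) = (d * d') * Z - d * (d' * Z - Y * D) := by
    rw [Matrix.mul_sub, Matrix.mul_assoc]; simp
  rw [e3, Matrix.sub_apply]
  refine Ideal.sub_mem _ ?_ ?_
  · rw [mul_comm]; exact mul_entry_mem _ _ _ _ hdd hZm i j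
  · exact mul_entry_mem _ _ _ _ hdm' hZ i j

/-- an ideal as submodule of `R^1` -/
def idealSub (I : Ideal R) : Submodule R (Fin 1 → R) := Submodule.comap (LinearMap.proj 0) I

lemma mem_idealSub (I : Ideal R) (v : Fin 1 → R) : v ∈ idealSub I ↔ v 0 ∈ I := Iff.rfl

lemma key (π : P →+* R) (hπ : Function.Surjective π) [IsLocalHom π] (J : Ideal P)
    (hJ : J ≤ maximalIdeal P) (n : ℕ) (hFR : FR R n 1 (idealSub (J.map π))) :
    RingHom.ker π ⊓ maximalIdeal P * J ≤ maximalIdeal P * RingHom.ker π := by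
  rintro f ⟨hf, hfJ⟩
  by_contra hf'
  obtain ⟨ι, _, _, i0, D, h1, h2, h3⟩ := MF_of_mem J hJ f hfJ
  have := key_claim π hπ f hf hf' D h1 h2 n 1 _ hFR (Matrix.of fun _ => Pi.single i0 1) (by
    intro j
    rw [mem_idealSub]
    refine Ideal.mem_map_of_mem _ ?_
    simpa [Matrix.mul_apply, Pi.single_apply] using h3 j) 0 i0
  simp at this

section basechange
variable [Algebra P R]

lemma ker_flat [Module.Flat P R] {b b' : ℕ} (d : Matrix (Fin b) (Fin b') P) (v : Fin b' → R)
    (hv : v ∈ LinearMap.ker (d.map (algebraMap P R)).mulVecLin) :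
    v ∈ Submodule.span R ((fun (w : Fin b' → P) i => algebraMap P R (w i)) ''
      (LinearMap.ker d.mulVecLin : Submodule P (Fin b' → P))) := by
  let f : (Fin b → P) →ₗ[P] (Fin b' → P) := d.transpose.mulVecLin
  let x : (Fin b' → P) →ₗ[P] R := Fintype.linearCombination P v
  have h0 : x ∘ₗ f = 0 := by
    ext i
    have := congrFun (LinearMap.mem_ker.1 hv) i
    rw [Matrix.mulVecLin_apply] at this
    simpa [x, f, Matrix.mulVec, dotProduct, Fintype.linearCombination_apply, Algebra.smul_def] using this
  obtain ⟨k, a, y, hxy, haf⟩ := Module.Flat.exists_factorization_of_comp_eq_zero_of_free h0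
  have hv' : v = ∑ κ, y (Finsupp.single κ 1) •
      (fun j => algebraMap P R (a (Pi.single j 1) κ)) := by
    ext j
    have h1 : x (Pi.single j 1) = v j := by simp [x]
    have h2 : a (Pi.single j 1) = ∑ κ, (a (Pi.single j 1) κ) • Finsupp.single κ (1 : P) := by
      ext; simp
    conv_lhs => rw [← h1, hxy, LinearMap.comp_apply, h2, map_sum]
    simp only [map_smul, Finset.sum_apply, Pi.smul_apply, smul_eq_mul]
    simp only [Algebra.smul_def, mul_comm]
  rw [hv']
  refine Submodule.sum_mem _ fun κ _ => Submodule.smul_mem _ _ (Submodule.subset_span ?_)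
  refine ⟨fun j => a (Pi.single j 1) κ, ?_, rfl⟩
  rw [SetLike.mem_coe, LinearMap.mem_ker, Matrix.mulVecLin_apply]
  ext i
  have h3 := congrArg (fun z => z κ) (LinearMap.congr_fun haf (Pi.single i 1))
  have h4 : f (Pi.single i 1) = ∑ j, d i j • (Pi.single j 1 : Fin b' → P) := by
    ext j
    simp [f, Finset.sum_apply, Pi.single_apply]
  simp only [LinearMap.comp_apply, h4, map_sum, map_smul] at h3
  simpa [Matrix.mulVec, dotProduct] using h3

lemma FR_baseChange [Module.Flat P R] [IsLocalHom (algebraMap P R)] (n b : ℕ)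
    (U : Submodule P (Fin b → P)) (h : FR P n b U) :
    FR R n b (Submodule.span R ((fun (w : Fin b → P) i => algebraMap P R (w i)) '' U)) := by
  induction n generalizing b with
  | zero => exact h
  | succ n ih =>
    obtain h | ⟨b', d, hd, rfl, hF⟩ := h
    · exact Or.inl h
    have hF' := ih _ _ hF
    refine Or.inr ⟨b', d.map (algebraMap P R), ?_, ?_, ?_⟩
    · intro i j
      have := hd i j
      rw [mem_maximalIdeal, mem_nonunits_iff] at this ⊢
      rwa [Matrix.map_apply, isUnit_map_iff]
    · apply le_antisymm
      · rw [Matrix.range_mulVecLin, Submodule.span_le]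
        rintro _ ⟨j, rfl⟩
        refine Submodule.subset_span ⟨d.col j, ?_, rfl⟩
        exact ⟨Pi.single j 1, by simp⟩
      · rw [Submodule.span_le]
        rintro _ ⟨_, ⟨w, rfl⟩, rfl⟩
        refine ⟨fun j => algebraMap P R (w j), ?_⟩
        ext i
        simp [Matrix.mulVec, dotProduct]
    · convert hF' using 1
      apply le_antisymm
      · intro v hv
        exact ker_flat d v hv
      · rw [Submodule.span_le]
        rintro _ ⟨w, hw, rfl⟩
        rw [SetLike.mem_coe, LinearMap.mem_ker] at hw ⊢
        ext i
        have := congrArg (algebraMap P R) (congrFun hw i)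
        simpa [Matrix.mulVec, dotProduct] using this

lemma FR_baseChange_ideal [Module.Flat P R] [IsLocalHom (algebraMap P R)] (n : ℕ)
    (I : Ideal P) (h : FR P n 1 (idealSub I)) : FR R n 1 (idealSub (I.map (algebraMap P R))) := by
  convert FR_baseChange (R := R) n 1 _ h using 1
  apply le_antisymm
  · intro v hv
    rw [mem_idealSub] at hv
    have key : ∀ x ∈ I.map (algebraMap P R), (fun _ : Fin 1 => x) ∈
        Submodule.span R ((fun (w : Fin 1 → P) i => algebraMap P R (w i)) '' (idealSub I)) := by
      intro x hx
      refine Submodule.span_induction (p := fun x _ => (fun _ : Fin 1 => x) ∈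
        Submodule.span R ((fun (w : Fin 1 → P) i => algebraMap P R (w i)) '' (idealSub I)))
        ?_ ?_ ?_ ?_ hx
      · rintro _ ⟨y, hy, rfl⟩
        exact Submodule.subset_span ⟨fun _ => y, hy, rfl⟩
      · exact Submodule.zero_mem _
      · intro x y _ _ h1 h2
        exact Submodule.add_mem _ h1 h2
      · intro a x _ h1
        exact Submodule.smul_mem _ a h1
    convert key _ hv using 1
    ext i
    rw [Subsingleton.elim i 0]
  · rw [Submodule.span_le]
    rintro _ ⟨w, hw, rfl⟩
    exact Ideal.mem_map_of_mem _ hw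

end basechange

end FR
end CIAD




set_option linter.unusedSectionVars false

namespace CIAD
open Ideal IsLocalRing RingTheory.Sequence

section pd
open CategoryTheory

variable {R : Type} [CommRing R]

lemma pd_quot {M N : Type} [AddCommGroup M] [AddCommGroup N] [Module R M] [Module R N]
    (p : M →ₗ[R] N) (hp : Function.Surjective p) (n : ℕ)
    (h1 : HasProjectiveDimensionLT (ModuleCat.of R (LinearMap.ker p)) n)
    (h2 : HasProjectiveDimensionLT (ModuleCat.of R M) (n + 1)) :
    HasProjectiveDimensionLT (ModuleCat.of R N) (n + 1) :=
  (LinearMap.shortExact_shortComplexKer hp).hasProjectiveDimensionLT_X₃ n h1 h2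

lemma pd_ker {M N : Type} [AddCommGroup M] [AddCommGroup N] [Module R M] [Module R N]
    (p : M →ₗ[R] N) (hp : Function.Surjective p) (n : ℕ)
    (h1 : HasProjectiveDimensionLT (ModuleCat.of R M) n)
    (h2 : HasProjectiveDimensionLT (ModuleCat.of R N) (n + 1)) :
    HasProjectiveDimensionLT (ModuleCat.of R (LinearMap.ker p)) n :=
  (LinearMap.shortExact_shortComplexKer hp).hasProjectiveDimensionLT_X₁ n h1 h2

lemma pd_of_equiv {M N : Type} [AddCommGroup M] [AddCommGroup N] [Module R M] [Module R N]
    (e : M ≃ₗ[R] N) (n : ℕ)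
    (h1 : HasProjectiveDimensionLT (ModuleCat.of R M) n) :
    HasProjectiveDimensionLT (ModuleCat.of R N) n :=
  hasProjectiveDimensionLT_of_iso e.toModuleIso n

lemma pd_proj {M : Type} [AddCommGroup M] [Module R M] [Module.Projective R M] (n : ℕ) :
    HasProjectiveDimensionLT (ModuleCat.of R M) (n + 1) := by
  have : Projective (ModuleCat.of R M) := (IsProjective.iff_projective M).1 inferInstance
  exact hasProjectiveDimensionLT_of_ge _ 1 _ (by omega)

variable [IsLocalRing R]

lemma exists_min_gens {b : ℕ} (U : Submodule R (Fin b → R)) (hU : U.FG) :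
    ∃ (b' : ℕ) (d : Matrix (Fin b) (Fin b') R), LinearMap.range d.mulVecLin = U ∧
      ∀ v ∈ LinearMap.ker d.mulVecLin, ∀ i, v i ∈ maximalIdeal R := by
  classical
  have hex : ∃ b' : ℕ, ∃ (d : Matrix (Fin b) (Fin b') R), LinearMap.range d.mulVecLin = U := by
    obtain ⟨n, s, hs⟩ := Submodule.fg_iff_exists_fin_generating_family.1 hU
    refine ⟨n, (Matrix.of s).transpose, ?_⟩
    rw [Matrix.range_mulVecLin, ← hs]
    rfl
  obtain ⟨d, hd⟩ := Nat.find_spec hex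
  have hmin := fun k => Nat.find_min hex (m := k)
  generalize Nat.find hex = b' at d hd hmin
  refine ⟨b', d, hd, fun v hv i => ?_⟩
  by_contra hi
  have hu : IsUnit (v i) := by simpa using hi
  obtain _ | k := b'
  · exact i.elim0
  refine hmin k (by omega) ⟨d.submatrix id i.succAbove, ?_⟩
  rw [← hd, Matrix.range_mulVecLin, Matrix.range_mulVecLin]
  apply le_antisymm
  · rw [Submodule.span_le]
    rintro _ ⟨j, rfl⟩
    exact Submodule.subset_span ⟨i.succAbove j, rfl⟩
  · rw [Submodule.span_le]
    rintro _ ⟨j, rfl⟩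
    rcases Fin.eq_self_or_eq_succAbove i j with rfl | ⟨j, rfl⟩
    · have h0 : v j • d.col j + ∑ l, v (j.succAbove l) • d.col (j.succAbove l) = 0 := by
        have := LinearMap.mem_ker.1 hv
        rw [Matrix.mulVecLin_apply] at this
        rw [← this, ← Fin.sum_univ_succAbove (fun l => v l • d.col l)]
        ext r
        simp [Matrix.mulVec, dotProduct, mul_comm]
      have h1 : v j • d.col j ∈ Submodule.span R
          (Set.range (d.submatrix id j.succAbove).col) := by
        rw [eq_neg_of_add_eq_zero_left h0]
        refine Submodule.neg_mem _ (Submodule.sum_mem _ fun l _ => Submodule.smul_mem _ _ ?_)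
        exact Submodule.subset_span ⟨l, rfl⟩
      obtain ⟨u, hu⟩ := hu
      have := Submodule.smul_mem _ (↑u⁻¹ : R) h1
      rwa [smul_smul, ← hu, Units.inv_mul, one_smul] at this
    · exact Submodule.subset_span ⟨j, rfl⟩

lemma ker_eq_bot_of_proj {b' : ℕ} {N : Type} [AddCommGroup N] [Module R N] [Module.Projective R N]
    [IsNoetherianRing R]
    (p : (Fin b' → R) →ₗ[R] N) (hp : Function.Surjective p)
    (hk : ∀ v ∈ LinearMap.ker p, ∀ i, v i ∈ maximalIdeal R) : LinearMap.ker p = ⊥ := by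
  obtain ⟨s, hs⟩ := Module.projective_lifting_property p LinearMap.id hp
  apply Submodule.eq_bot_of_le_smul_of_le_jacobson_bot (maximalIdeal R) _ (IsNoetherian.noetherian _)
    _ (IsLocalRing.maximalIdeal_le_jacobson _)
  intro v hv
  let q : (Fin b' → R) →ₗ[R] (Fin b' → R) := LinearMap.id - s ∘ₗ p
  have hq : ∀ w, q w ∈ LinearMap.ker p := by
    intro w
    have := LinearMap.congr_fun hs (p w)
    simp only [LinearMap.comp_apply, LinearMap.id_apply] at this
    simp [q, this]
  have hqv : q v = v := by simp [q, LinearMap.mem_ker.1 hv]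
  have hv2 : v = ∑ i, v i • q (Pi.single i 1) := by
    conv_lhs => rw [← hqv, pi_eq_sum_univ' v, map_sum]
    simp
  rw [hv2]
  exact Submodule.sum_mem _ fun i _ => Submodule.smul_mem_smul (hk v hv i) (hq _)

lemma FR_of_pd [IsNoetherianRing R] (n b : ℕ) (U : Submodule R (Fin b → R))
    (hU : ∀ v ∈ U, ∀ i, v i ∈ maximalIdeal R)
    (h : HasProjectiveDimensionLT (ModuleCat.of R U) n) : FR R (n + 1) b U := by
  induction n generalizing b with
  | zero =>
    have h0 := isZero_of_hasProjectiveDimensionLT_zero (ModuleCat.of R U)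
    rw [ModuleCat.isZero_iff_subsingleton] at h0
    have h0 : Subsingleton U := h0
    refine Or.inr ⟨0, 0, by simp, ?_, rfl⟩
    rw [Submodule.subsingleton_iff_eq_bot] at h0
    rw [h0, eq_bot_iff]
    rintro _ ⟨w, rfl⟩
    ext; simp
  | succ n ih =>
    obtain ⟨b', d, hd, hk⟩ := exists_min_gens U (IsNoetherian.noetherian U)
    subst hd
    refine Or.inr ⟨b', d, ?_, rfl, ?_⟩
    · intro i j
      have := hU (d.mulVecLin (Pi.single j 1)) ⟨_, rfl⟩ i
      simpa using this
    · refine ih b' _ hk ?_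
      have hs := LinearMap.surjective_rangeRestrict d.mulVecLin
      obtain _ | n := n
      · have hp : Projective (ModuleCat.of R (LinearMap.range d.mulVecLin)) :=
          projective_iff_hasProjectiveDimensionLT_one.2 h
        have hp : Module.Projective R (LinearMap.range d.mulVecLin) :=
          (IsProjective.iff_projective _).2 hp
        have hb := ker_eq_bot_of_proj d.mulVecLin.rangeRestrict hs
          (by rw [LinearMap.ker_rangeRestrict]; exact hk)
        rw [LinearMap.ker_rangeRestrict] at hb
        apply Limits.IsZero.hasProjectiveDimensionLT_zero
        rw [ModuleCat.isZero_iff_subsingleton]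
        exact Submodule.subsingleton_iff_eq_bot.2 hb
      · have := pd_ker d.mulVecLin.rangeRestrict hs (n + 1) (pd_proj n) h
        rwa [LinearMap.ker_rangeRestrict] at this

lemma FR_of_pd_quot [IsNoetherianRing R] (n : ℕ) {M : Type} [AddCommGroup M] [Module R M]
    (p : R →ₗ[R] M) (hp : Function.Surjective p) (hk : LinearMap.ker p ≤ maximalIdeal R)
    (h : HasProjectiveDimensionLT (ModuleCat.of R M) n) :
    ∃ k, FR R k 1 (idealSub (LinearMap.ker p)) := by
  let p' : (Fin 1 → R) →ₗ[R] M := p ∘ₗ LinearMap.proj 0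
  have hp' : Function.Surjective p' := fun x => by
    obtain ⟨y, rfl⟩ := hp x
    exact ⟨fun _ => y, rfl⟩
  have h1 : HasProjectiveDimensionLT (ModuleCat.of R M) (n + 1 + 1) :=
    hasProjectiveDimensionLT_of_ge _ n _ (by omega)
  have := pd_ker p' hp' (n + 1) (pd_proj n) h1
  refine ⟨n + 1 + 1, FR_of_pd (n + 1) 1 (idealSub (LinearMap.ker p)) ?_ this⟩
  intro v hv i
  rw [Subsingleton.elim i 0]
  exact hk hv

end pd

end CIAD




set_option linter.unusedSectionVars false

namespace CIAD
open Ideal IsLocalRing RingTheory.Sequence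

section pd
open CategoryTheory

variable {R : Type} [CommRing R]

lemma epi_zero {Z : ModuleCat R} (Q : ProjectiveResolution Z) : Epi (Q.π.f 0) := inferInstance

lemma pd_of_finite {M : Type} [AddCommGroup M] [Module R M]
    (h : HasFiniteProjectiveDimension R M) :
    ∃ n, HasProjectiveDimensionLT (ModuleCat.of R M) n := by
  obtain ⟨n, P, f, hf, hP, hz⟩ := h
  let Q : ProjectiveResolution (ModuleCat.of R M) := { complex := P, projective := hP, π := f, quasiIso := hf }
  have claim : ∀ k i, n < i + 1 + k → HasProjectiveDimensionLT
      (ModuleCat.of R (LinearMap.range (P.d (i + 1) i).hom)) k := by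
    intro k
    induction k with
    | zero =>
      intro i hi
      apply Limits.IsZero.hasProjectiveDimensionLT_zero
      rw [ModuleCat.isZero_iff_subsingleton]
      have := hz (i + 1) (by omega)
      rw [ModuleCat.isZero_iff_subsingleton] at this
      refine Submodule.subsingleton_iff_eq_bot.2 ?_
      rw [eq_bot_iff]
      rintro _ ⟨w, rfl⟩
      rw [Subsingleton.elim w 0, map_zero]
      exact Submodule.zero_mem _
    | succ k ih =>
      intro i hi
      have h1 := ih (i + 1) (by omega)
      have hp := LinearMap.surjective_rangeRestrict (P.d (i + 1) i).hom
      have hp1 : Module.Projective R (P.X (i + 1)) :=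
        (IsProjective.iff_projective (P.X (i + 1))).2 (hP (i + 1))
      refine pd_quot _ hp k ?_ (pd_proj k)
      have hex := (Q.exact_succ i).moduleCat_range_eq_ker
      have hex : LinearMap.range (P.d (i + 1 + 1) (i + 1)).hom =
        LinearMap.ker (P.d (i + 1) i).hom := hex
      rw [LinearMap.ker_rangeRestrict]
      rwa [hex] at h1
  refine ⟨n + 1, ?_⟩
  have h0 := claim n 0 (by omega)
  have hp0 : Module.Projective R (P.X 0) :=
        (IsProjective.iff_projective (P.X 0)).2 (hP 0)
  let p : P.X 0 →ₗ[R] M := (f.f 0).hom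
  have hex := (Q.exact₀).moduleCat_range_eq_ker
  have hex : LinearMap.range (P.d (0 + 1) 0).hom = LinearMap.ker p := hex
  rw [hex] at h0
  refine pd_quot p ?_ n h0 (pd_proj n)
  have := epi_zero Q
  exact (ModuleCat.epi_iff_surjective _).1 this

lemma FR_of_RS [IsLocalRing R] [IsNoetherianRing R] (rs : List R) (h : RS rs) :
    ∃ k, FR R k 1 (idealSub (ofList rs)) := by
  have h1 := ModuleCat.projectiveDimension_quotient_eq_length.{0} rs ((isRegular_iff rs).2 h)
  have h2 : HasProjectiveDimensionLT (ModuleCat.of R (Shrink.{0} (R ⧸ Ideal.ofList rs)))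
      (rs.length + 1) := by
    rw [← projectiveDimension_lt_iff, h1]
    exact_mod_cast Nat.lt_succ_self _
  have h3 := pd_of_equiv (Shrink.linearEquiv R (R ⧸ Ideal.ofList rs)) _ h2
  obtain ⟨k, hk⟩ := FR_of_pd_quot _ (Submodule.mkQ (Ideal.ofList rs)) (Submodule.mkQ_surjective _)
    (by rw [Submodule.ker_mkQ]; exact h.2) h3
  rw [Submodule.ker_mkQ] at hk
  exact ⟨k, hk⟩

end pd
end CIAD


set_option linter.unusedSectionVars false
namespace CIAD
open Ideal IsLocalRing RingTheory.Sequence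

lemma exists_map_list {C D : Type*} (f : C → D) (hf : Function.Surjective f) (hs : List D) :
    ∃ hs' : List C, hs'.map f = hs := by
  induction hs with
  | nil => exact ⟨[], rfl⟩
  | cons a l ih =>
    obtain ⟨l', rfl⟩ := ih
    obtain ⟨x, rfl⟩ := hf a
    exact ⟨x :: l', rfl⟩

lemma map_ofList {C D : Type*} [CommRing C] [CommRing D] (f : C →+* D) (l : List C) :
    (ofList l).map f = ofList (l.map f) := by
  simp only [Ideal.ofList, Ideal.map_span]
  congr 1
  ext x
  simp

lemma RS_lift {C D : Type*} [CommRing C] [IsLocalRing C] [CommRing D] [IsLocalRing D]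
    (f : C →+* D) (hf : Function.Surjective f) (gs : List C) (hgs : RS gs)
    (hk : ofList gs = RingHom.ker f) (hs : List D) (h : RS hs) :
    ∃ hs' : List C, hs'.map f = hs ∧ RS (gs ++ hs') ∧
      ofList (gs ++ hs') = (ofList hs).comap f := by
  obtain ⟨hs', rfl⟩ := exists_map_list f hf hs
  have e : ofList (gs ++ hs') = (ofList (hs'.map f)).comap f := by
    rw [← map_ofList, Ideal.comap_map_of_surjective f hf, ofList_append, hk, sup_comm]
    rfl
  have : IsLocalHom f := hf.isLocalHom f
  refine ⟨hs', rfl, ⟨?_, ?_⟩, e⟩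
  · rw [WR_append]
    refine ⟨hgs.1, ?_⟩
    rw [hk, bot_sup_eq, WR_ker f hf]
    exact h.1
  · rw [e, ← IsLocalRing.maximalIdeal_comap f]
    exact Ideal.comap_mono h.2

theorem reg_exists (n : ℕ) : ∀ (C : Type*) [CommRing C] [IsRegularLocalRing C],
    (maximalIdeal C).spanFinrank = n →
    IsDomain C ∧ ∃ ys : List C, RS ys ∧ ofList ys = maximalIdeal C := by
  induction n with
  | zero =>
    intro C _ _ h
    rw [Submodule.spanFinrank_eq_zero_iff_eq_bot (IsNoetherian.noetherian _)] at h
    have hF : IsField C := IsLocalRing.isField_iff_maximalIdeal_eq.2 h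
    refine ⟨hF.isDomain, [], ⟨trivial, by simp⟩, by simp [h]⟩
  | succ d ih =>
    intro C _ _ h
    have hdim : ringKrullDim C = ((d + 1 : ℕ) : WithBot ℕ∞) := by
      rw [← IsRegularLocalRing.spanFinrank_maximalIdeal, h]
    have hm0 : maximalIdeal C ≠ ⊥ := by
      intro h0; rw [h0] at h; simp at h
    -- choose y
    have hfin : (minimalPrimes C).Finite := minimalPrimes.finite_of_isNoetherianRing C
    obtain ⟨y, hym, hy2, hymin⟩ : ∃ y ∈ maximalIdeal C, y ∉ maximalIdeal C ^ 2 ∧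
        ∀ p ∈ minimalPrimes C, y ∉ p := by
      by_contra! hcon
      classical
      have := (Ideal.subset_union_prime (s := insert (maximalIdeal C ^ 2) hfin.toFinset)
        (f := id) (maximalIdeal C ^ 2) (maximalIdeal C ^ 2) (I := maximalIdeal C) ?_).1 ?_
      · obtain ⟨p, hp, hle⟩ := this
        rw [Finset.mem_insert] at hp
        rcases hp with rfl | hp
        · apply hm0
          apply Submodule.eq_bot_of_le_smul_of_le_jacobson_bot (maximalIdeal C) _
            (IsNoetherian.noetherian _) _ (IsLocalRing.maximalIdeal_le_jacobson _)
          rw [smul_eq_mul, ← pow_two]; exact hle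
        · rw [Set.Finite.mem_toFinset] at hp
          have hpp : p.IsPrime := hp.1.1
          have : p = maximalIdeal C := le_antisymm (le_maximalIdeal hpp.ne_top) hle
          have h1 : (maximalIdeal C).height = 0 := by
            rw [Ideal.height_eq_zero_iff]
            rwa [← this]
          have := IsLocalRing.maximalIdeal_height_eq_ringKrullDim (R := C)
          rw [h1, hdim] at this
          norm_cast at this
      · intro i hi h1 _
        rw [Finset.mem_insert] at hi
        rcases hi with rfl | hi
        · exact absurd rfl h1
        · rw [Set.Finite.mem_toFinset] at hi
          exact hi.1.1
      · intro x hx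
        simp only [Set.mem_iUnion]
        by_cases hx2 : x ∈ maximalIdeal C ^ 2
        · exact ⟨_, by simp, hx2⟩
        · obtain ⟨p, hp, hxp⟩ := hcon x hx hx2
          exact ⟨p, by simp [hp], hxp⟩
    obtain ⟨s, hs, hsp⟩ := Submodule.FG.exists_span_finset_card_eq_spanFinrank
      (IsNoetherian.noetherian (maximalIdeal C))
    have hl : ofList s.toList = maximalIdeal C := by
      rw [← hsp]; simp [Ideal.ofList, Ideal.span]
    obtain ⟨rs', hlen, hgen⟩ : ∃ rs' : List C, rs'.length = d ∧
        maximalIdeal C = span {y} ⊔ ofList rs' := by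
      rcases pick ⊥ s.toList y (by rw [hl]; simpa using hym) with h1 | ⟨h0, hs', hp, c, hc, h2⟩
      · rw [hl, bot_sup_eq, ← pow_two] at h1; exact absurd h1 hy2
      · refine ⟨hs', ?_, ?_⟩
        · have := hp.length_eq; simp at this; omega
        · rw [bot_sup_eq] at h2
          have e : maximalIdeal C = ofList (h0 :: hs') := by rw [← hl, ofList_perm hp]
          rw [ofList_cons] at e
          apply le_antisymm
          · rw [e]
            refine sup_le ?_ le_sup_right
            rw [Ideal.span_singleton_le_iff_mem]
            obtain ⟨u, rfl⟩ := hc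
            have : h0 = ↑u⁻¹ * y - ↑u⁻¹ * (y - u * h0) := by
              rw [mul_sub]; simp
            rw [this]
            refine Ideal.sub_mem _ (Ideal.mul_mem_left _ _ (mle le_sup_left
              (Ideal.mem_span_singleton_self y))) (Ideal.mul_mem_left _ _ (mle le_sup_right h2))
          · refine sup_le ((Ideal.span_singleton_le_iff_mem _).2 hym) ?_
            rw [e]; exact le_sup_right
    have hyle : span {y} ≤ maximalIdeal C := (Ideal.span_singleton_le_iff_mem _).2 hym
    have hnt : Nontrivial (C ⧸ span {y}) :=
      Ideal.Quotient.nontrivial_iff.2 (fun h => (maximalIdeal.isMaximal C).ne_top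
        (top_le_iff.1 (h ▸ hyle)))
    have hsurj := Ideal.Quotient.mk_surjective (I := span {y})
    have hloc : IsLocalRing (C ⧸ span {y}) := IsLocalRing.of_surjective' _ hsurj
    have hmax : maximalIdeal (C ⧸ span {y}) = ofList (rs'.map (Ideal.Quotient.mk (span {y}))) := by
      rw [← map_ofList, ← IsLocalRing.map_maximalIdeal_of_surjective _ hsurj, hgen, Ideal.map_sup,
        Ideal.map_quotient_self, bot_sup_eq]
    have hsf : (maximalIdeal (C ⧸ span {y})).spanFinrank ≤ d := by
      rw [hmax]
      refine (Submodule.spanFinrank_span_le_ncard_of_finite (List.finite_toSet _)).trans ?_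
      classical
      rw [show {x | x ∈ rs'.map (Ideal.Quotient.mk (span {y}))} =
        ((rs'.map (Ideal.Quotient.mk (span {y}))).toFinset : Set _) by ext; simp,
        Set.ncard_coe_finset]
      exact (List.toFinset_card_le _).trans (by simp [hlen])
    have hge : ((d : ℕ) : WithBot ℕ∞) ≤ ringKrullDim (C ⧸ span {y}) := by
      have h1 := ringKrullDim_le_ringKrullDim_quotient_add_spanFinrank (span {y})
        (by rw [IsLocalRing.ringJacobson_eq_maximalIdeal]; exact hyle)
      rw [hdim] at h1
      have h2 : (span {y} : Ideal C).spanFinrank ≤ 1 :=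
        (Submodule.spanFinrank_span_le_ncard_of_finite (Set.finite_singleton y)).trans (by simp)
      have h3 : ((d + 1 : ℕ) : WithBot ℕ∞) ≤ ringKrullDim (C ⧸ span {y}) + 1 := by
        refine h1.trans ?_
        gcongr
        exact_mod_cast h2
      push_cast at h3
      exact (WithBot.add_le_add_iff_right' (α := ℕ) (c := 1) (by decide)
        (by decide)).1 h3
    have hreg : IsRegularLocalRing (C ⧸ span {y}) :=
      IsRegularLocalRing.of_spanFinrank_maximalIdeal_le _ (le_trans (by exact_mod_cast hsf) hge)
    have hsd : (maximalIdeal (C ⧸ span {y})).spanFinrank = d := by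
      have := hreg.spanFinrank_maximalIdeal
      rw [← this] at hge
      exact le_antisymm hsf (by exact_mod_cast hge)
    obtain ⟨hdom, ys, hys, hysm⟩ := ih (C ⧸ span {y}) hsd
    have hpr : (span {y} : Ideal C).IsPrime := (Ideal.Quotient.isDomain_iff_prime _).1 hdom
    obtain ⟨p, hp, hple⟩ := Ideal.exists_minimalPrimes_le (bot_le : (⊥ : Ideal C) ≤ span {y})
    have hpp : p.IsPrime := hp.1.1
    have hyp := hymin p hp
    have hp0 : p = ⊥ := by
      apply Submodule.eq_bot_of_le_smul_of_le_jacobson_bot (maximalIdeal C) _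
        (IsNoetherian.noetherian _) _ (IsLocalRing.maximalIdeal_le_jacobson _)
      intro x hx
      obtain ⟨a, rfl⟩ := Ideal.mem_span_singleton'.1 (hple hx)
      rcases hpp.mem_or_mem hx with ha | h'
      · rw [mul_comm]; exact Submodule.smul_mem_smul hym ha
      · exact absurd h' hyp
    have hdC : IsDomain C := by
      rw [hp0] at hpp
      exact IsDomain.of_bot_isPrime C
    have hy0 : y ≠ 0 := fun h => hy2 (h ▸ Ideal.zero_mem _)
    refine ⟨hdC, ?_⟩
    obtain ⟨hs', -, h1, h2⟩ := RS_lift (Ideal.Quotient.mk (span {y})) hsurj [y]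
      ⟨by rw [WR_singleton]; intro b hb; simpa [hy0] using hb, by simpa using hyle⟩
      (by simp) ys hys
    refine ⟨_, h1, ?_⟩
    have : IsLocalHom (Ideal.Quotient.mk (span {y})) := hsurj.isLocalHom _
    rw [h2, hysm, IsLocalRing.maximalIdeal_comap]

theorem reg_GG (C : Type*) [CommRing C] [IsRegularLocalRing C] : GG (⊥ : Ideal C) := by
  obtain ⟨-, ys, h1, h2⟩ := reg_exists _ C rfl
  exact GG_bot h1 h2

end CIAD


set_option linter.unusedSectionVars false
namespace CIAD
open Ideal IsLocalRing RingTheory.Sequence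

section colim
universe u v
variable {A : Type u} [CommRing A] [IsLocalRing A]

lemma det_pow (j : ℕ) : ∀ x ∈ maximalIdeal A ^ j, ∃ T : Finset A,
    ∀ (C : Type v) [CommRing C] [IsLocalRing C] (ψ : C →+* A) [IsLocalHom ψ],
      (T : Set A) ⊆ Set.range ψ → ∃ x' ∈ maximalIdeal C ^ j, ψ x' = x := by
  classical
  induction j with
  | zero =>
    intro x _
    refine ⟨{x}, fun C _ _ ψ _ h => ?_⟩
    obtain ⟨x', hx'⟩ := h (by simp : x ∈ (({x} : Finset A) : Set A))
    exact ⟨x', by simp, hx'⟩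
  | succ j ih =>
    intro x hx
    rw [pow_succ] at hx
    refine Submodule.mul_induction_on hx ?_ ?_
    · intro u hu v hv
      obtain ⟨T, hT⟩ := ih u hu
      refine ⟨insert v T, fun C _ _ ψ _ h => ?_⟩
      rw [Finset.coe_insert, Set.insert_subset_iff] at h
      obtain ⟨u', hu', rfl⟩ := hT C ψ h.2
      obtain ⟨v', rfl⟩ := h.1
      refine ⟨u' * v', ?_, by simp⟩
      rw [pow_succ]
      exact Ideal.mul_mem_mul hu' (by rwa [← IsLocalRing.maximalIdeal_comap ψ])
    · rintro a b ⟨T, hT⟩ ⟨T', hT'⟩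
      refine ⟨T ∪ T', fun C _ _ ψ _ h => ?_⟩
      rw [Finset.coe_union, Set.union_subset_iff] at h
      obtain ⟨a', ha', rfl⟩ := hT C ψ h.1
      obtain ⟨b', hb', rfl⟩ := hT' C ψ h.2
      exact ⟨a' + b', Ideal.add_mem _ ha' hb', by simp⟩

lemma det_list (l : List A) : ∀ x ∈ ofList l, ∃ T : Finset A,
    ∀ (C : Type v) [CommRing C] [IsLocalRing C] (ψ : C →+* A) [IsLocalHom ψ],
      (T : Set A) ⊆ Set.range ψ → ∀ l' : List C, l'.map ψ = l → ∃ x' ∈ ofList l', ψ x' = x := by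
  classical
  induction l with
  | nil =>
    intro x hx
    refine ⟨∅, fun C _ _ ψ _ h l' hl' => ⟨0, by simp, ?_⟩⟩
    simpa [eq_comm] using hx
  | cons a l ih =>
    intro x hx
    rw [ofList_cons, Submodule.mem_sup] at hx
    obtain ⟨y, hy, z, hz, rfl⟩ := hx
    obtain ⟨r, rfl⟩ := Ideal.mem_span_singleton'.1 hy
    obtain ⟨T, hT⟩ := ih z hz
    refine ⟨insert r T, fun C _ _ ψ _ h l' hl' => ?_⟩
    rw [Finset.coe_insert, Set.insert_subset_iff] at h
    obtain ⟨a', l', rfl⟩ : ∃ a' l'', l' = a' :: l'' := by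
      cases l' with
      | nil => simp at hl'
      | cons a' l'' => exact ⟨_, _, rfl⟩
    rw [List.map_cons, List.cons.injEq] at hl'
    obtain ⟨rfl, hl'⟩ := hl'
    obtain ⟨z', hz', rfl⟩ := hT C ψ h.2 l' hl'
    obtain ⟨r', rfl⟩ := h.1
    refine ⟨r' * a' + z', ?_, by simp⟩
    rw [ofList_cons]
    exact Submodule.add_mem_sup (Ideal.mem_span_singleton'.2 ⟨_, rfl⟩) hz'

lemma map_sup_pow_le {C : Type v} [CommRing C] [IsLocalRing C] (ψ : C →+* A) [IsLocalHom ψ]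
    (l : List C) (k : ℕ) {x : C} (hx : x ∈ (⊥ : Ideal C) ⊔ ofList l ⊔ maximalIdeal C ^ k) :
    ψ x ∈ (⊥ : Ideal A) ⊔ ofList (l.map ψ) ⊔ maximalIdeal A ^ k := by
  have h := Ideal.mem_map_of_mem ψ hx
  rw [Ideal.map_sup, Ideal.map_sup, Ideal.map_bot, map_ofList, Ideal.map_pow] at h
  refine mle (sup_le_sup le_rfl (Ideal.pow_right_mono ?_ k)) h
  rw [Ideal.map_le_iff_le_comap, IsLocalRing.maximalIdeal_comap]

lemma Chain.pull {C : Type v} [CommRing C] [IsLocalRing C] (ψ : C →+* A) [IsLocalHom ψ]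
    (l : List C) (h : Chain (⊥ : Ideal A) (l.map ψ)) : Chain (⊥ : Ideal C) l := by
  induction l with
  | nil => trivial
  | cons y l ih =>
    refine ⟨ih h.1, ?_, fun h' => h.2.2 (map_sup_pow_le ψ l 2 h')⟩
    rw [← IsLocalRing.maximalIdeal_comap ψ]
    exact h.2.1

lemma GG_colim (h : ∀ T : Finset A, ∃ (C : Type v) (_ : CommRing C) (_ : IsLocalRing C)
    (ψ : C →+* A), IsLocalHom ψ ∧ Function.Injective ψ ∧ GG (⊥ : Ideal C) ∧
      (T : Set A) ⊆ Set.range ψ) : GG (⊥ : Ideal A) := by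
  classical
  intro y l hc k b hb
  rw [bot_sup_eq, Submodule.mem_sup] at hb
  obtain ⟨u, hu, v, hv, huv⟩ := hb
  obtain ⟨T₁, h₁⟩ := det_list.{u, v} l u hu
  obtain ⟨T₂, h₂⟩ := det_pow.{u, v} (k + 1) v hv
  obtain ⟨C, _, _, ψ, _, hinj, hG, hT⟩ := h (insert y (insert b (T₁ ∪ T₂ ∪ l.toFinset)))
  simp only [Finset.coe_insert, Finset.coe_union, Set.insert_subset_iff,
    Set.union_subset_iff] at hT
  obtain ⟨⟨y, rfl⟩, ⟨b, rfl⟩, ⟨hT₁, hT₂⟩, hT₃⟩ := hT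
  obtain ⟨l', rfl⟩ : ∃ l' : List C, l'.map ψ = l := by
    have : ∀ x ∈ l, ∃ a, ψ a = x := fun x hx => hT₃ (by simpa using hx)
    clear * - this
    induction l with
    | nil => exact ⟨[], rfl⟩
    | cons a l ih =>
      obtain ⟨a', rfl⟩ := this a (by simp)
      obtain ⟨l', rfl⟩ := ih (fun x hx => this x (by simp [hx]))
      exact ⟨a' :: l', rfl⟩
  obtain ⟨u, hu', rfl⟩ := h₁ C ψ hT₁ l' rfl
  obtain ⟨v, hv', rfl⟩ := h₂ C ψ hT₂
  rw [← map_add, ← map_mul] at huv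
  have e := hinj huv
  refine map_sup_pow_le ψ l' k (hG y l' (Chain.pull ψ (y :: l') hc) k b ?_)
  rw [← e, bot_sup_eq]
  exact Submodule.add_mem_sup hu' hv'

end colim

theorem GG_loc {E : Type} (q : Ideal (MvPolynomial E ℤ)) [q.IsPrime] :
    GG (⊥ : Ideal (Localization.AtPrime q)) := by
  classical
  apply GG_colim.{0, 0}
  intro T
  obtain ⟨V, hV⟩ : ∃ V : Finset E, ∀ x ∈ T, ∃ (p s : MvPolynomial V ℤ),
      MvPolynomial.rename Subtype.val s ∉ q ∧
      algebraMap _ _ (MvPolynomial.rename Subtype.val s) * x =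
        algebraMap _ (Localization.AtPrime q) (MvPolynomial.rename Subtype.val p) := by
    choose p s hps using fun x : Localization.AtPrime q => IsLocalization.exists_mk'_eq q.primeCompl x
    refine ⟨T.biUnion fun x => (p x).vars ∪ (s x : MvPolynomial E ℤ).vars, fun x hx => ?_⟩
    have h1 : ((p x).vars : Set E) ⊆
        Set.range (Subtype.val : (T.biUnion fun x => (p x).vars ∪
          (s x : MvPolynomial E ℤ).vars) → E) := by
      intro e he
      exact ⟨⟨e, Finset.mem_biUnion.2 ⟨x, hx, Finset.mem_union_left _ he⟩⟩, rfl⟩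
    have h2 : ((s x : MvPolynomial E ℤ).vars : Set E) ⊆
        Set.range (Subtype.val : (T.biUnion fun x => (p x).vars ∪
          (s x : MvPolynomial E ℤ).vars) → E) := by
      intro e he
      exact ⟨⟨e, Finset.mem_biUnion.2 ⟨x, hx, Finset.mem_union_right _ he⟩⟩, rfl⟩
    obtain ⟨p', hp'⟩ := MvPolynomial.exists_rename_eq_of_vars_subset_range _ _
      Subtype.val_injective h1
    obtain ⟨s', hs'⟩ := MvPolynomial.exists_rename_eq_of_vars_subset_range _ _
      Subtype.val_injective h2
    refine ⟨p', s', ?_, ?_⟩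
    · rw [hs']; exact (s x).2
    · rw [hs', hp']
      have := IsLocalization.mk'_spec' (Localization.AtPrime q) (p x) (s x)
      rwa [hps x] at this
  let f : MvPolynomial V ℤ →+* MvPolynomial E ℤ := (MvPolynomial.rename Subtype.val).toRingHom
  have hf : Function.Injective f := MvPolynomial.rename_injective _ Subtype.val_injective
  let ψ := Localization.localRingHom (q.comap f) q f rfl
  refine ⟨Localization.AtPrime (q.comap f), inferInstance, inferInstance, ψ,
    inferInstance, ?_, reg_GG _, ?_⟩
  · rw [injective_iff_map_eq_zero]
    intro z hz
    obtain ⟨p, s, rfl⟩ := IsLocalization.exists_mk'_eq (q.comap f).primeCompl z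
    simp only [ψ, Localization.localRingHom_mk'] at hz
    rw [IsLocalization.mk'_eq_zero_iff] at hz ⊢
    obtain ⟨m, hm⟩ := hz
    have hm0 : (m : MvPolynomial E ℤ) ≠ 0 := fun h => m.2 (by rw [h]; exact q.zero_mem)
    have : f p = 0 := (mul_eq_zero.1 hm).resolve_left hm0
    refine ⟨1, ?_⟩
    rw [hf (this.trans (map_zero f).symm)]; simp
  · intro x hx
    obtain ⟨p, s, hs, e⟩ := hV x hx
    refine ⟨IsLocalization.mk' _ p (⟨s, hs⟩ : (q.comap f).primeCompl), ?_⟩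
    simp only [ψ, Localization.localRingHom_mk']
    rw [IsLocalization.mk'_eq_iff_eq_mul]
    rw [mul_comm]
    exact e.symm

end CIAD


set_option linter.unusedSectionVars false
namespace CIAD
open Ideal IsLocalRing RingTheory.Sequence

/-- Complete separated multiplicative filtrations. -/
structure Filt {P : Type*} [CommRing P] (F : ℕ → Ideal P) : Prop where
  anti : Antitone F
  zero : F 0 = ⊤
  mul : ∀ i j, F i * F j ≤ F (i + j)
  compl : ∀ x : ℕ → P, (∀ k, x (k + 1) - x k ∈ F k) → ∃ a, ∀ k, a - x k ∈ F k
  sep : ∀ a, (∀ k, a ∈ F k) → a = 0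

section
variable {P : Type*} [CommRing P] {F : ℕ → Ideal P}

lemma Filt.pow_mem (h : Filt F) {y : P} (hy : y ∈ F 1) (n : ℕ) : y ^ n ∈ F n := by
  induction n with
  | zero => rw [h.zero]; trivial
  | succ n ih => rw [pow_succ]; exact h.mul n 1 (Ideal.mul_mem_mul ih hy)

lemma Filt.isUnit (h : Filt F) {y : P} (hy : y ∈ F 1) : IsUnit (1 - y) := by
  obtain ⟨a, ha⟩ := h.compl (fun n => ∑ i ∈ Finset.range n, y ^ i) (fun k => by
    rw [Finset.sum_range_succ, add_sub_cancel_left]; exact h.pow_mem hy k)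
  refine IsUnit.of_mul_eq_one a ?_
  rw [← sub_eq_zero]
  refine h.sep _ fun k => ?_
  have e := mul_neg_geom_sum y k
  have : (1 - y) * a - 1 = (1 - y) * (a - ∑ i ∈ Finset.range k, y ^ i) - y ^ k := by
    rw [mul_sub, e]; ring
  rw [this]
  exact Ideal.sub_mem _ (Ideal.mul_mem_left _ _ (ha k)) (h.pow_mem hy k)

lemma Filt.quot (h : Filt F) {y : P} (hy : ∀ b k, y * b ∈ F (k + 1) → b ∈ F k) {D : Type*}
    [CommRing D] (f : P →+* D) (hf : Function.Surjective f) (hk : RingHom.ker f = span {y}) :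
    Filt (fun k => (F k).map f) where
  anti i j hij := Ideal.map_mono (h.anti hij)
  zero := by simp [h.zero, Ideal.map_top]
  mul i j := by rw [← Ideal.map_mul]; exact Ideal.map_mono (h.mul i j)
  compl x hx := by
    choose d hd hd' using fun k => (Ideal.mem_map_iff_of_surjective f hf).1 (hx k)
    obtain ⟨x0, hx0⟩ := hf (x 0)
    obtain ⟨a, ha⟩ := h.compl (fun n => x0 + ∑ i ∈ Finset.range n, d i) (fun k => by
      rw [Finset.sum_range_succ, ← add_assoc, add_sub_cancel_left]; exact hd k)
    refine ⟨f a, fun k => ?_⟩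
    have : x k = f (x0 + ∑ i ∈ Finset.range k, d i) := by
      induction k with
      | zero => simp [hx0]
      | succ k ih =>
        rw [Finset.sum_range_succ, ← add_assoc, map_add, ← ih, hd']; ring
    rw [this, ← map_sub]
    exact Ideal.mem_map_of_mem f (ha k)
  sep a ha := by
    obtain ⟨x, rfl⟩ := hf a
    have h1 : ∀ k, ∃ b, x - y * b ∈ F k := by
      intro k
      have : x ∈ ((F k).map f).comap f := ha k
      rw [Ideal.comap_map_of_surjective' f hf, hk, Submodule.mem_sup] at this
      obtain ⟨u, hu, v, hv, rfl⟩ := this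
      obtain ⟨b, rfl⟩ := Ideal.mem_span_singleton'.1 hv
      exact ⟨b, by rwa [mul_comm b y, add_sub_cancel_right]⟩
    choose b hb using fun k => h1 (k + 1)
    obtain ⟨c, hc⟩ := h.compl b (fun k => hy _ _ (by
      have := Ideal.sub_mem _ (hb k) (h.anti (Nat.le_succ (k + 1)) (hb (k + 1)))
      rwa [show x - y * b k - (x - y * b (k + 1)) = y * (b (k + 1) - b k) by ring] at this))
    have : x - y * c = 0 := h.sep _ fun k => by
      rw [show x - y * c = (x - y * b k) - y * (c - b k) by ring]
      exact Ideal.sub_mem _ (h.anti (Nat.le_succ k) (hb k)) (Ideal.mul_mem_left _ _ (hc k))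
    rw [sub_eq_zero.1 this, ← RingHom.mem_ker, hk]
    exact Ideal.mul_mem_right _ _ (Ideal.mem_span_singleton_self y)

lemma Filt.noeth (h : Filt F) {y : P} (hy1 : y ∈ F 1) {D : Type*}
    [CommRing D] [IsNoetherianRing D] (f : P →+* D) (hf : Function.Surjective f)
    (hk : RingHom.ker f = span {y}) : IsNoetherianRing P := by
  apply IsNoetherianRing.of_prime
  intro p hp
  obtain ⟨r, g, hg⟩ := Submodule.fg_iff_exists_fin_generating_family.1
    (IsNoetherian.noetherian (p.map f))
  have hgm : ∀ i, g i ∈ p.map f := fun i => by rw [← hg]; exact Submodule.subset_span ⟨i, rfl⟩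
  choose a ha hag using fun i => (Ideal.mem_map_iff_of_surjective f hf).1 (hgm i)
  have key : ∀ x ∈ p, ∃ (c : Fin r → P) (z : P), x = ∑ i, c i * a i + y * z := by
    intro x hx
    have : f x ∈ p.map f := Ideal.mem_map_of_mem f hx
    rw [← hg, Submodule.mem_span_range_iff_exists_fun] at this
    obtain ⟨c, hc⟩ := this
    choose c' hc' using fun i => hf (c i)
    have : x - ∑ i, c' i * a i ∈ RingHom.ker f := by
      rw [RingHom.mem_ker, map_sub, ← hc, map_sum, sub_eq_zero]
      simp [hc', hag]
    rw [hk] at this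
    obtain ⟨z, hz⟩ := Ideal.mem_span_singleton'.1 this
    exact ⟨c', z, by rw [mul_comm y z, hz]; ring⟩
  have hsum : ∀ c : Fin r → P, ∑ i, c i * a i ∈ p := fun c =>
    Ideal.sum_mem _ fun i _ => Ideal.mul_mem_left _ _ (ha i)
  have hle : span (Set.range a) ≤ p := Ideal.span_le.2 (by rintro _ ⟨i, rfl⟩; exact ha i)
  have hsum' : ∀ c : Fin r → P, ∑ i, c i * a i ∈ span (Set.range a) := fun c =>
    Ideal.sum_mem _ fun i _ => Ideal.mul_mem_left _ _ (Ideal.subset_span ⟨i, rfl⟩)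
  by_cases hyp : y ∈ p
  · have : p = span (insert y (Set.range a)) := by
      apply le_antisymm
      · intro x hx
        obtain ⟨c, z, rfl⟩ := key x hx
        refine Ideal.add_mem _ (Ideal.span_mono (Set.subset_insert _ _) (hsum' c))
          (Ideal.mul_mem_right _ _ (Ideal.subset_span (Set.mem_insert _ _)))
      · rw [Ideal.span_insert]
        exact sup_le ((Ideal.span_singleton_le_iff_mem _).2 hyp) hle
    rw [this]
    exact Submodule.fg_span ((Set.finite_range a).insert y)
  · have : p = span (Set.range a) := by
      apply le_antisymm _ hle
      intro x hx
      have key' : ∀ x : p, ∃ (c : Fin r → P) (z : p), (x : P) = ∑ i, c i * a i + y * z := by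
        rintro ⟨x, hx⟩
        obtain ⟨c, z, e⟩ := key x hx
        have : y * z ∈ p := by
          have := Ideal.sub_mem _ hx (hsum c)
          rwa [e, add_sub_cancel_left] at this
        exact ⟨c, ⟨z, (hp.mem_or_mem this).resolve_left hyp⟩, e⟩
      choose ρ ζ hρ using key'
      let z : ℕ → p := fun n => ζ^[n] ⟨x, hx⟩
      have hz : ∀ n, z (n + 1) = ζ (z n) := fun n => Function.iterate_succ_apply' _ _ _
      choose c hc using fun i => h.compl (fun n => ∑ j ∈ Finset.range n, y ^ j * ρ (z j) i)
        (fun k => by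
          rw [Finset.sum_range_succ, add_sub_cancel_left]
          exact Ideal.mul_mem_right _ _ (h.pow_mem hy1 k))
      have hx' : ∀ n, x = ∑ i, (∑ j ∈ Finset.range n, y ^ j * ρ (z j) i) * a i + y ^ n * z n := by
        intro n
        induction n with
        | zero => simp [z]
        | succ n ih =>
          simp only [Finset.sum_range_succ, add_mul, Finset.sum_add_distrib]
          rw [hz]
          conv_lhs => rw [ih, hρ (z n)]
          rw [mul_add, Finset.mul_sum, pow_succ, add_assoc]
          simp only [mul_assoc]
      have : x - ∑ i, c i * a i = 0 := h.sep _ fun n => by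
        rw [show x - ∑ i, c i * a i = y ^ n * z n -
          ∑ i, (c i - ∑ j ∈ Finset.range n, y ^ j * ρ (z j) i) * a i by
            conv_lhs => rw [hx' n]
            simp only [sub_mul, Finset.sum_sub_distrib]; ring]
        refine Ideal.sub_mem _ (Ideal.mul_mem_right _ _ (h.pow_mem hy1 n))
          (Ideal.sum_mem _ fun i _ => Ideal.mul_mem_right _ _ (hc i n))
      rw [sub_eq_zero.1 this]
      exact hsum' c
    rw [this]
    exact Submodule.fg_span (Set.finite_range a)

end

/-- regularity with respect to a filtration -/
def WRF {P : Type*} [CommRing P] : (ℕ → Ideal P) → List P → Prop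
  | _, [] => True
  | F, y :: l => (∀ b k, y * b ∈ F (k + 1) → b ∈ F k) ∧ WRF (fun k => F k ⊔ span {y}) l

lemma WRF_comap {P D : Type*} [CommRing P] [CommRing D] (f : P →+* D)
    (hf : Function.Surjective f) (l : List P) (G : ℕ → Ideal D)
    (h : WRF (fun k => (G k).comap f) l) : WRF G (l.map f) := by
  induction l generalizing G with
  | nil => trivial
  | cons y l ih =>
    refine ⟨fun b k hb => ?_, ih _ ?_⟩
    · obtain ⟨b, rfl⟩ := hf b
      exact h.1 b k (by simpa using hb)
    · convert h.2 using 2 with k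
      rw [← Set.image_singleton, ← Ideal.map_span]
      rw [← Ideal.map_comap_of_surjective f hf (G k), ← Ideal.map_sup,
        Ideal.comap_map_of_surjective' f hf]
      rw [sup_assoc, sup_comm (span {y}), ← sup_assoc]
      congr 1
      exact sup_eq_left.2 (Ideal.comap_mono bot_le)

lemma Filt.isLocalRing {P : Type*} [CommRing P] {F : ℕ → Ideal P} (h : Filt F)
    (hm : (F 1).IsMaximal) : IsLocalRing P := by
  refine IsLocalRing.of_unique_max_ideal ⟨F 1, hm, fun M hM => ?_⟩
  by_contra hne
  have : F 1 ⊔ M = ⊤ := hm.coprime_of_ne hM (Ne.symm hne)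
  obtain ⟨a, ha, b, hb, hab⟩ := Submodule.mem_sup.1
    (show (1 : P) ∈ F 1 ⊔ M by rw [this]; trivial)
  have := h.isUnit ha
  rw [← hab, add_sub_cancel_left] at this
  exact hM.ne_top (Ideal.eq_top_of_isUnit_mem _ hb this)

theorem filt_main (n : ℕ) : ∀ (P : Type*) [CommRing P] (F : ℕ → Ideal P) (ys : List P),
    ys.length = n → Filt F → (F 1).IsMaximal → WRF F ys → (∀ y ∈ ys, y ∈ F 1) →
    (∀ k, F 1 ≤ ofList ys ⊔ F k) →
    IsNoetherianRing P ∧ WR ⊥ ys ∧ ofList ys = F 1 := by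
  induction n with
  | zero =>
    intro P _ F ys hn hF hm hW hys hle
    obtain rfl := List.length_eq_zero_iff.1 hn
    have h0 : F 1 = ⊥ := by
      rw [eq_bot_iff]
      intro x hx
      exact hF.sep x fun k => by simpa using hle k hx
    have hfield : IsField P := by
      rw [h0] at hm
      have : Nontrivial P := by
        by_contra hn
        rw [not_nontrivial_iff_subsingleton] at hn
        exact hm.ne_top (Subsingleton.elim _ _)
      exact Ring.isField_iff_maximal_bot.2 hm
    let := hfield.toField
    exact ⟨inferInstance, trivial, by simp [h0]⟩
  | succ n ih =>
    intro P _ F ys hn hF hm hW hys hle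
    obtain ⟨y, l, rfl⟩ : ∃ y l, ys = y :: l := by
      cases ys with
      | nil => simp at hn
      | cons y l => exact ⟨_, _, rfl⟩
    have hy1 : y ∈ F 1 := hys y (by simp)
    let f := Ideal.Quotient.mk (span {y})
    have hf : Function.Surjective f := Ideal.Quotient.mk_surjective
    have hk : RingHom.ker f = span {y} := Ideal.mk_ker
    have hcm : ∀ I : Ideal P, (I.map f).comap f = I ⊔ span {y} := fun I => by
      rw [Ideal.comap_map_of_surjective' f hf, hk]
    have hF1 : F 1 ⊔ span {y} = F 1 := sup_eq_left.2 ((Ideal.span_singleton_le_iff_mem _).2 hy1)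
    have hm' : ((F 1).map f).IsMaximal := by
      refine (Ideal.map_eq_top_or_isMaximal_of_surjective f hf hm).resolve_left fun h => ?_
      have := hcm (F 1)
      rw [h, hF1, Ideal.comap_top] at this
      exact hm.ne_top this.symm
    obtain ⟨h1, h2, h3⟩ := ih (P ⧸ span {y}) (fun k => (F k).map f) (l.map f)
      (by simpa using hn) (hF.quot hW.1 f hf hk) hm'
      (WRF_comap f hf l _ (by simp only [hcm]; exact hW.2))
      (by
        intro z hz
        obtain ⟨w, hw, rfl⟩ := List.mem_map.1 hz
        exact Ideal.mem_map_of_mem f (hys w (by simp [hw])))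
      (by
        intro k
        have := Ideal.map_mono (f := f) (hle k)
        rw [Ideal.map_sup, ofList_cons, Ideal.map_sup, map_ofList] at this
        rwa [show (span {y}).map f = ⊥ from Ideal.map_quotient_self _, bot_sup_eq] at this)
    refine ⟨hF.noeth hy1 f hf hk, ⟨?_, ?_⟩, ?_⟩
    · intro b hb
      exact hF.sep b fun k => hW.1 b k (by rw [(Submodule.mem_bot P).1 hb]; exact Ideal.zero_mem _)
    · rw [bot_sup_eq, ← hk, WR_ker f hf]; exact h2
    · have := congrArg (Ideal.comap f) h3
      rw [← map_ofList, hcm, hcm, hF1] at this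
      rw [ofList_cons, sup_comm, this]

end CIAD


set_option linter.unusedSectionVars false
namespace CIAD
open Ideal IsLocalRing RingTheory.Sequence

section zorn
variable {A : Type*} [CommRing A] [IsLocalRing A]

lemma Chain.mono {c c' : Ideal A} (h : c ≤ c') {l : List A} (hl : Chain c' l) : Chain c l := by
  induction l with
  | nil => trivial
  | cons y l ih =>
    exact ⟨ih hl.1, hl.2.1, fun h' => hl.2.2 (mle (sup_le_sup (sup_le_sup h le_rfl) le_rfl) h')⟩

lemma sup_snoc (c : Ideal A) (l : List A) (g : A) (J : Ideal A) :
    c ⊔ span {g} ⊔ ofList l ⊔ J = c ⊔ ofList (l ++ [g]) ⊔ J := by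
  rw [ofList_append, ofList_singleton, sup_assoc c, sup_comm (span {g})]

lemma Chain.snoc {c : Ideal A} {g : A} (hg : g ∈ maximalIdeal A) (hg' : g ∉ c ⊔ maximalIdeal A ^ 2)
    {l : List A} (h : Chain (c ⊔ span {g}) l) : Chain c (l ++ [g]) := by
  induction l with
  | nil => exact ⟨trivial, hg, by simpa using hg'⟩
  | cons y l ih =>
    refine ⟨ih h.1, h.2.1, fun h' => h.2.2 ?_⟩
    rw [sup_snoc]; exact h'

lemma GG.adjoin {c : Ideal A} (h : GG c) {g : A} (hg : g ∈ maximalIdeal A)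
    (hg' : g ∉ c ⊔ maximalIdeal A ^ 2) : GG (c ⊔ span {g}) := by
  intro y l hc k b hb
  rw [sup_snoc] at hb ⊢
  exact h y (l ++ [g]) (Chain.snoc hg hg' (l := y :: l) hc) k b hb

lemma exists_max (N : Ideal A) (hN : N ≤ maximalIdeal A) (h : GG (⊥ : Ideal A)) :
    ∃ c ≤ N, GG c ∧ N ≤ c ⊔ maximalIdeal A ^ 2 := by
  obtain ⟨c, -, hc⟩ := zorn_le_nonempty₀ {c : Ideal A | c ≤ N ∧ GG c} (by
    intro S hS hch c₀ hc₀
    have hne : S.Nonempty := ⟨c₀, hc₀⟩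
    refine ⟨sSup S, ⟨sSup_le fun d hd => (hS hd).1, ?_⟩, fun d hd => le_sSup hd⟩
    intro y l hc k b hb
    rw [sup_assoc, Submodule.mem_sup] at hb
    obtain ⟨u, hu, v, hv, huv⟩ := hb
    rw [Submodule.mem_sSup_of_directed hne hch.directedOn] at hu
    obtain ⟨d, hd, hud⟩ := hu
    have hb' : y * b ∈ d ⊔ ofList l ⊔ maximalIdeal A ^ (k + 1) := by
      rw [sup_assoc, ← huv]; exact Submodule.add_mem_sup hud hv
    exact mle (sup_le_sup (sup_le_sup (le_sSup hd) le_rfl) le_rfl)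
      ((hS hd).2 y l (Chain.mono (le_sSup hd) hc) k b hb')) ⊥ ⟨bot_le, h⟩
  refine ⟨c, hc.prop.1, hc.prop.2, fun g hg => ?_⟩
  by_contra hcon
  have := hc.le_of_ge (y := c ⊔ span {g}) ⟨sup_le hc.prop.1 ((Ideal.span_singleton_le_iff_mem _).2 hg),
    hc.prop.2.adjoin (hN hg) hcon⟩ le_sup_left
  exact hcon (mle le_sup_left (this (mle le_sup_right (Ideal.mem_span_singleton_self g))))

lemma exists_chain (c : Ideal A) (t : List A) (ht : ofList t ≤ maximalIdeal A) :
    ∃ l, Chain c l ∧ ofList t ≤ c ⊔ ofList l ⊔ maximalIdeal A ^ 2 := by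
  induction t with
  | nil => exact ⟨[], trivial, by simp⟩
  | cons y t ih =>
    rw [ofList_cons, sup_le_iff] at ht
    obtain ⟨l, hl, hle⟩ := ih ht.2
    by_cases hy : y ∈ c ⊔ ofList l ⊔ maximalIdeal A ^ 2
    · refine ⟨l, hl, ?_⟩
      rw [ofList_cons]
      exact sup_le ((Ideal.span_singleton_le_iff_mem _).2 hy) hle
    · refine ⟨y :: l, ⟨hl, (Ideal.span_singleton_le_iff_mem _).1 ht.1, hy⟩, ?_⟩
      rw [ofList_cons, ofList_cons]
      refine sup_le (le_sup_of_le_left (le_sup_of_le_right le_sup_left)) (hle.trans ?_)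
      exact sup_le_sup (sup_le_sup le_rfl le_sup_right) le_rfl

lemma le_sup_pow (J m : Ideal A) (h : m ≤ J ⊔ m ^ 2) (k : ℕ) : m ≤ J ⊔ m ^ (k + 1) := by
  induction k with
  | zero => simp
  | succ k ih =>
    refine ih.trans (sup_le le_sup_left ?_)
    calc m ^ (k + 1) = m ^ k * m := pow_succ _ _
      _ ≤ m ^ k * (J ⊔ m ^ 2) := Ideal.mul_mono_right h
      _ = m ^ k * J ⊔ m ^ (k + 1 + 1) := by rw [Ideal.mul_sup, ← pow_add]
      _ ≤ J ⊔ m ^ (k + 1 + 1) := sup_le_sup Ideal.mul_le_right le_rfl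
end zorn

section PC
variable {A : Type*} [CommRing A]

/-- The completion along a filtration. -/
def Pc (I : ℕ → Ideal A) : Subring (∀ k, A ⧸ I k) where
  carrier := {x | ∀ j k, j ≤ k → ∃ a, x j = Ideal.Quotient.mk _ a ∧ x k = Ideal.Quotient.mk _ a}
  zero_mem' _ _ _ := ⟨0, rfl, rfl⟩
  one_mem' _ _ _ := ⟨1, rfl, rfl⟩
  add_mem' {x y} hx hy j k h := by
    obtain ⟨a, h1, h2⟩ := hx j k h
    obtain ⟨b, h3, h4⟩ := hy j k h
    exact ⟨a + b, by simp [h1, h3], by simp [h2, h4]⟩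
  mul_mem' {x y} hx hy j k h := by
    obtain ⟨a, h1, h2⟩ := hx j k h
    obtain ⟨b, h3, h4⟩ := hy j k h
    exact ⟨a * b, by simp [h1, h3], by simp [h2, h4]⟩
  neg_mem' {x} hx j k h := by
    obtain ⟨a, h1, h2⟩ := hx j k h
    exact ⟨-a, by simp [h1], by simp [h2]⟩

variable {I : ℕ → Ideal A}

/-- evaluation -/
def Pc.ev (I : ℕ → Ideal A) (k : ℕ) : Pc I →+* A ⧸ I k := (Pi.evalRingHom _ k).comp (Pc I).subtype

/-- the canonical map -/
def Pc.of (I : ℕ → Ideal A) : A →+* Pc I :=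
  (RingHom.pi fun k => Ideal.Quotient.mk (I k)).codRestrict (Pc I)
    fun a _ _ _ => ⟨a, rfl, rfl⟩

lemma Pc.ev_of (k : ℕ) (a : A) : Pc.ev I k (Pc.of I a) = Ideal.Quotient.mk _ a := rfl

lemma Pc.ext' {x y : Pc I} (h : ∀ k, Pc.ev I k x = Pc.ev I k y) : x = y :=
  Subtype.ext (funext h)

lemma Pc.exists_rep (x : Pc I) (k : ℕ) : ∃ a, Pc.ev I k x = Ideal.Quotient.mk _ a := by
  obtain ⟨a, h, -⟩ := x.2 k k le_rfl
  exact ⟨a, h⟩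

lemma Pc.ev_le (hI : Antitone I) (x : Pc I) {j k : ℕ} (h : j ≤ k) {a : A}
    (ha : Pc.ev I k x = Ideal.Quotient.mk _ a) : Pc.ev I j x = Ideal.Quotient.mk _ a := by
  obtain ⟨b, h1, h2⟩ := x.2 j k h
  have h3 : Pc.ev I k x = Ideal.Quotient.mk _ b := h2
  have h4 : Pc.ev I j x = Ideal.Quotient.mk _ b := h1
  rw [h4]
  rw [h3, Ideal.Quotient.eq] at ha
  rw [Ideal.Quotient.eq]
  exact hI h ha

lemma Pc.filt (hI : Antitone I) (h0 : I 0 = ⊤) (hmul : ∀ i j, I i * I j ≤ I (i + j)) :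
    Filt (fun k => RingHom.ker (Pc.ev I k)) where
  anti j k h x hx := by
    rw [RingHom.mem_ker] at hx ⊢
    rw [Pc.ev_le hI x h (a := 0) (by simpa using hx)]; simp
  zero := by
    have : Subsingleton (A ⧸ I 0) := Ideal.Quotient.subsingleton_iff.2 h0
    rw [eq_top_iff]; intro x _; exact Subsingleton.elim _ _
  mul i j := by
    rw [Ideal.mul_le]
    intro x hx y hy
    rw [RingHom.mem_ker] at *
    obtain ⟨a, ha⟩ := Pc.exists_rep x (i + j)
    obtain ⟨b, hb⟩ := Pc.exists_rep y (i + j)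
    rw [Pc.ev_le hI x (Nat.le_add_right i j) ha, Ideal.Quotient.eq_zero_iff_mem] at hx
    rw [Pc.ev_le hI y (Nat.le_add_left j i) hb, Ideal.Quotient.eq_zero_iff_mem] at hy
    rw [map_mul, ha, hb, ← map_mul, Ideal.Quotient.eq_zero_iff_mem]
    exact hmul i j (Ideal.mul_mem_mul hx hy)
  compl x hx := by
    have h1 : ∀ j d, Pc.ev I j (x (j + d)) = Pc.ev I j (x j) := by
      intro j d
      induction d with
      | zero => rfl
      | succ d ih =>
        rw [← ih, ← sub_eq_zero, ← map_sub]
        obtain hx' := hx (j + d)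
        rw [RingHom.mem_ker] at hx'
        have := Pc.ev_le hI (x (j + d + 1) - x (j + d)) (Nat.le_add_right j d) (a := 0)
          (by simpa using hx')
        rw [map_zero] at this
        exact this
    refine ⟨⟨fun k => Pc.ev I k (x k), fun j k h => ?_⟩, fun k => ?_⟩
    · obtain ⟨d, rfl⟩ := Nat.exists_eq_add_of_le h
      show ∃ a, Pc.ev I j (x j) = _ ∧ Pc.ev I (j + d) (x (j + d)) = _
      rw [← h1 j d]
      exact (x (j + d)).2 j (j + d) h
    · rw [RingHom.mem_ker, map_sub, sub_eq_zero]; rfl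
  sep x hx := Pc.ext' fun k => by rw [map_zero]; exact hx k

end PC

section PC2
variable {A : Type*} [CommRing A] [IsLocalRing A]

lemma Pc.step (c : Ideal A) (hG : GG c) (y : A) (l : List A) (hc : Chain c (y :: l)) :
    let I := fun k => c ⊔ maximalIdeal A ^ k
    ∀ (b : Pc I) (k : ℕ), Pc.of I y * b ∈ RingHom.ker (Pc.ev I (k + 1)) ⊔ ofList (l.map (Pc.of I)) →
      b ∈ RingHom.ker (Pc.ev I k) ⊔ ofList (l.map (Pc.of I)) := by
  intro I b k hb
  have hI : Antitone I := fun i j h => sup_le_sup le_rfl (Ideal.pow_le_pow_right h)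
  obtain ⟨β, hβ⟩ := Pc.exists_rep b (k + 1)
  have h1 : Pc.ev I (k + 1) (Pc.of I y * b) ∈
      (ofList l).map (Ideal.Quotient.mk (I (k + 1))) := by
    have := Ideal.mem_map_of_mem (Pc.ev I (k + 1)) hb
    rw [Ideal.map_sup, map_ofList, List.map_map] at this
    have h0 : (RingHom.ker (Pc.ev I (k + 1))).map (Pc.ev I (k + 1)) = ⊥ :=
      (Ideal.map_eq_bot_iff_le_ker _).2 le_rfl
    rw [h0, bot_sup_eq] at this
    rw [map_ofList]
    exact this
  rw [map_mul, Pc.ev_of, hβ, ← map_mul] at h1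
  have h2 : y * β ∈ c ⊔ ofList l ⊔ maximalIdeal A ^ (k + 1) := by
    have : y * β ∈ ((ofList l).map (Ideal.Quotient.mk (I (k + 1)))).comap _ := h1
    rw [Ideal.comap_map_of_surjective' _ Ideal.Quotient.mk_surjective, Ideal.mk_ker] at this
    refine mle ?_ this
    refine sup_le (le_sup_of_le_left le_sup_right) ?_
    exact sup_le_sup le_sup_left le_rfl
  have h3 := hG y l hc k β h2
  have h4 : c ⊔ ofList l ⊔ maximalIdeal A ^ k = I k ⊔ ofList l := sup_right_comm _ _ _
  rw [h4, Submodule.mem_sup] at h3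
  obtain ⟨e, he, d, hd, rfl⟩ := h3
  have h5 := Pc.ev_le hI b (Nat.le_succ k) hβ
  rw [← sub_add_cancel b (Pc.of I d)]
  refine Submodule.add_mem_sup ?_ ?_
  · rw [RingHom.mem_ker, map_sub, h5, Pc.ev_of, ← map_sub, add_sub_cancel_right,
      Ideal.Quotient.eq_zero_iff_mem]
    exact he
  · rw [← map_ofList]; exact Ideal.mem_map_of_mem _ hd

lemma Chain.suffix {c : Ideal A} {l l' : List A} (h : Chain c (l ++ l')) : Chain c l' := by
  induction l with
  | nil => exact h
  | cons y l ih => exact ih h.1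

lemma Pc.WRF (c : Ideal A) (hG : GG c) (l' : List A) : ∀ l : List A, Chain c (l'.reverse ++ l) →
    let I := fun k => c ⊔ maximalIdeal A ^ k
    WRF (fun k => RingHom.ker (Pc.ev I k) ⊔ ofList (l.map (Pc.of I))) (l'.map (Pc.of I)) := by
  induction l' with
  | nil => intro l _ I; trivial
  | cons y t ih =>
    intro l hc I
    rw [List.reverse_cons, List.append_assoc, List.singleton_append] at hc
    refine ⟨Pc.step c hG y l (Chain.suffix hc), ?_⟩
    have := ih (y :: l) hc
    simp only [List.map_cons, ofList_cons] at this
    convert this using 2 with k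
    rw [sup_assoc, sup_comm (span _)]

theorem Pc.main (c : Ideal A) (hc : c ≤ maximalIdeal A) (hG : GG c) (t : List A)
    (ht : ofList t ≤ maximalIdeal A)
    (hm : maximalIdeal A ≤ c ⊔ ofList t ⊔ maximalIdeal A ^ 2) :
    let I := fun k => c ⊔ maximalIdeal A ^ k
    IsNoetherianRing (Pc I) ∧ ∃ _ : IsLocalRing (Pc I),
      maximalIdeal (Pc I) = RingHom.ker (Pc.ev I 1) ∧ 
      ∃ zs : List (Pc I), RS zs ∧ ofList zs = maximalIdeal (Pc I) := by
  intro I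
  have hI : Antitone I := fun i j h => sup_le_sup le_rfl (Ideal.pow_le_pow_right h)
  have h0 : I 0 = ⊤ := by simp [I]
  have hmul : ∀ i j, I i * I j ≤ I (i + j) := by
    intro i j
    simp only [I, Ideal.sup_mul, Ideal.mul_sup, ← pow_add]
    refine sup_le (sup_le ?_ ?_) (sup_le ?_ le_sup_right)
    · exact le_sup_of_le_left Ideal.mul_le_left
    · exact le_sup_of_le_left Ideal.mul_le_right
    · exact le_sup_of_le_left Ideal.mul_le_left
  have hI1 : I 1 = maximalIdeal A := by simp [I, hc]
  have hF := Pc.filt hI h0 hmul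
  have hmax : (RingHom.ker (Pc.ev I 1)).IsMaximal := by
    have : (I 1).IsMaximal := by rw [hI1]; infer_instance
    let := Ideal.Quotient.field (I 1)
    refine RingHom.ker_isMaximal_of_surjective (K := A ⧸ I 1) (Pc.ev I 1) fun x => ?_
    obtain ⟨a, rfl⟩ := Ideal.Quotient.mk_surjective x
    exact ⟨Pc.of I a, rfl⟩
  obtain ⟨l, hl, hle⟩ := exists_chain c t ht
  have hml : maximalIdeal A ≤ c ⊔ ofList l ⊔ maximalIdeal A ^ 2 :=
    hm.trans (sup_le (sup_le (le_sup_of_le_left le_sup_left) hle) le_sup_right)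
  have hW := Pc.WRF c hG l.reverse [] (by simpa using hl)
  simp only [List.map_nil, ofList_nil, sup_bot_eq] at hW
  have hlm : ∀ l, Chain c l → ∀ y ∈ l, y ∈ maximalIdeal A := by
    intro l hl
    induction l with
    | nil => simp
    | cons y l ih => intro z hz; rcases List.mem_cons.1 hz with rfl | h; exacts [hl.2.1, ih hl.1 z h]
  have hrev : ofList (l.reverse.map (Pc.of I)) = (ofList l).map (Pc.of I) := by
    rw [map_ofList]; exact ofList_perm ((List.reverse_perm l).map _)
  obtain ⟨r1, r2, r3⟩ := filt_main _ (Pc I) _ (l.reverse.map (Pc.of I)) rfl hF hmax hW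
    (by
      intro y hy
      obtain ⟨w, hw, rfl⟩ := List.mem_map.1 hy
      rw [RingHom.mem_ker, Pc.ev_of, Ideal.Quotient.eq_zero_iff_mem, hI1]
      exact hlm l hl w (by simpa using hw))
    (by
      intro k x hx
      rw [hrev]
      cases k with
      | zero => rw [hF.zero]; simp
      | succ k =>
        obtain ⟨a, ha⟩ := Pc.exists_rep x (k + 1)
        rw [RingHom.mem_ker, Pc.ev_le hI x (Nat.le_add_left 1 k) ha,
          Ideal.Quotient.eq_zero_iff_mem, hI1] at hx
        have hx := le_sup_pow _ _ hml k hx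
        have h4 : c ⊔ ofList l ⊔ maximalIdeal A ^ (k + 1) = ofList l ⊔ I (k + 1) := by
          rw [sup_comm c, sup_assoc]
        rw [h4, Submodule.mem_sup] at hx
        obtain ⟨d, hd, e, he, rfl⟩ := hx
        rw [← add_sub_cancel (Pc.of I d) x]
        refine Submodule.add_mem_sup (Ideal.mem_map_of_mem _ hd) ?_
        rw [RingHom.mem_ker, map_sub, ha, Pc.ev_of, ← map_sub, add_sub_cancel_left,
          Ideal.Quotient.eq_zero_iff_mem]
        exact he)
  have hloc := hF.isLocalRing hmax
  have hm' : maximalIdeal (Pc I) = RingHom.ker (Pc.ev I 1) := (IsLocalRing.eq_maximalIdeal hmax).symm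
  exact ⟨r1, hloc, hm', _, ⟨r2, by rw [r3, hm']⟩, by rw [r3, hm']⟩

end PC2
end CIAD


set_option linter.unusedSectionVars false
namespace CIAD
open Ideal IsLocalRing RingTheory.Sequence

section hat

/-- The completion of a local ring. -/
abbrev Hat (R : Type) [CommRing R] [IsLocalRing R] : Type := AdicCompletion (maximalIdeal R) R

lemma haus_eq {T : Type} [CommRing T] (I : Ideal T) [IsHausdorff I T] {x y : T}
    (h : ∀ k, x - y ∈ I ^ k) : x = y := by
  rw [IsHausdorff.eq_iff_smodEq (I := I)]
  intro n
  rw [SModEq.sub_mem]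
  simpa using h n

/-- Lifting to a complete ring. -/
lemma lift_gen {X A T : Type} [CommRing X] [CommRing A] [CommRing T] (IT : Ideal T)
    [IsAdicComplete IT T] (J : ℕ → Ideal A) (e : ∀ k, X →+* A ⧸ J k)
    (he : ∀ x j k, j ≤ k → ∀ a, e k x = Ideal.Quotient.mk _ a → e j x = Ideal.Quotient.mk _ a)
    (g : A →+* T) (hg : ∀ k, J k ≤ (IT ^ k).comap g) :
    ∃ ĝ : X →+* T, ∀ x k a, e k x = Ideal.Quotient.mk _ a → ĝ x - g a ∈ IT ^ k := by
  let f : ∀ n, X →+* T ⧸ IT ^ n := fun n => (Ideal.quotientMap (IT ^ n) g (hg n)).comp (e n)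
  have hf : ∀ {m n : ℕ} (hle : m ≤ n), (Ideal.Quotient.factorPow IT hle).comp (f n) = f m := by
    intro m n hle
    ext x
    obtain ⟨a, ha⟩ := Ideal.Quotient.mk_surjective (e n x)
    have := he x m n hle a ha.symm
    simp only [f, RingHom.comp_apply, this, ← ha, Ideal.quotientMap_mk]
    rfl
  refine ⟨IsAdicComplete.liftRingHom IT f hf, fun x k a h => ?_⟩
  rw [← Ideal.Quotient.eq, IsAdicComplete.mk_liftRingHom]
  simp only [f, RingHom.comp_apply, h, Ideal.quotientMap_mk]

variable {R : Type} [CommRing R] [IsLocalRing R] [IsNoetherianRing R]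

lemma hat_mem_pow (x : Hat R) (n : ℕ) :
    x ∈ maximalIdeal (Hat R) ^ n ↔ AdicCompletion.evalₐ (maximalIdeal R) n x = 0 := by
  have fg := (maximalIdeal R).fg_of_isNoetherianRing
  rw [AdicCompletion.maximalIdeal_eq_map, ← Ideal.map_pow, ← Submodule.restrictScalars_mem R,
    ← Ideal.smul_top_eq_map, AdicCompletion.pow_smul_top_eq_ker_eval fg, LinearMap.mem_ker]
  constructor
  · intro h
    rw [← AdicCompletion.factor_eval_eq_evalₐ _ _ (by simp), h, map_zero]
  · intro h
    rw [← AdicCompletion.factor_evalₐ_eq_eval _ _ (by simp), h, map_zero]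

lemma hat_of_mem_pow (a : R) (n : ℕ) :
    algebraMap R (Hat R) a ∈ maximalIdeal (Hat R) ^ n ↔ a ∈ maximalIdeal R ^ n := by
  rw [hat_mem_pow, AdicCompletion.algebraMap_apply]
  change AdicCompletion.evalₐ (maximalIdeal R) n (AdicCompletion.of _ R a) = 0 ↔ _
  rw [AdicCompletion.evalₐ_of, Ideal.Quotient.eq_zero_iff_mem]

lemma hat_rep (x : Hat R) (n : ℕ) (a : R) :
    AdicCompletion.evalₐ (maximalIdeal R) n x = Ideal.Quotient.mk _ a ↔
      x - algebraMap R (Hat R) a ∈ maximalIdeal (Hat R) ^ n := by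
  rw [hat_mem_pow, map_sub, AdicCompletion.algebraMap_apply, sub_eq_zero]
  change _ ↔ _ = AdicCompletion.evalₐ (maximalIdeal R) n (AdicCompletion.of _ R a)
  rw [AdicCompletion.evalₐ_of]

lemma hat_exists (x : Hat R) (n : ℕ) :
    ∃ a, x - algebraMap R (Hat R) a ∈ maximalIdeal (Hat R) ^ n := by
  obtain ⟨a, ha⟩ := Ideal.Quotient.mk_surjective (AdicCompletion.evalₐ (maximalIdeal R) n x)
  exact ⟨a, (hat_rep x n a).1 ha.symm⟩

lemma hat_lift {T : Type} [CommRing T] [IsLocalRing T] [IsAdicComplete (maximalIdeal T) T]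
    (g : R →+* T) [IsLocalHom g] : ∃ ĝ : Hat R →+* T, ĝ.comp (algebraMap R (Hat R)) = g := by
  obtain ⟨ĝ, h⟩ := lift_gen (X := Hat R) (maximalIdeal T) (fun k => maximalIdeal R ^ k)
    (fun k => (AdicCompletion.evalₐ (maximalIdeal R) k).toRingHom)
    (fun x j k hjk a ha => (hat_rep x j a).2 (Ideal.pow_le_pow_right hjk ((hat_rep x k a).1 ha)))
    g (fun k => by
      rw [← Ideal.map_le_iff_le_comap, Ideal.map_pow]
      exact Ideal.pow_right_mono (((local_hom_TFAE g).out 0 2).1 ‹_›) k)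
  refine ⟨ĝ, RingHom.ext fun a => haus_eq (maximalIdeal T) fun k => ?_⟩
  exact h _ k a ((hat_rep _ k a).2 (by simp))

/-- Surjectivity after completion. -/
lemma hat_surj {T : Type} [CommRing T] [IsLocalRing T] [IsAdicComplete (maximalIdeal T) T]
    (g : R →+* T) (hm : (maximalIdeal R).map g = maximalIdeal T)
    (hs : Function.Surjective ((residue T).comp g))
    (ĝ : Hat R →+* T) (h : ĝ.comp (algebraMap R (Hat R)) = g) : Function.Surjective ĝ := by
  have hm' : (maximalIdeal (Hat R)).map ĝ = maximalIdeal T := by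
    rw [AdicCompletion.maximalIdeal_eq_map, Ideal.map_map, h, hm]
  have : IsHausdorff ((maximalIdeal (Hat R)).map ĝ) T := by rw [hm']; infer_instance
  refine surjective_of_mk_map_comp_surjective (I := maximalIdeal (Hat R)) ĝ fun x => ?_
  obtain ⟨t, rfl⟩ := Ideal.Quotient.mk_surjective x
  obtain ⟨a, ha⟩ := hs (residue T t)
  refine ⟨algebraMap R (Hat R) a, ?_⟩
  rw [RingHom.comp_apply, ← RingHom.comp_apply ĝ, h, Ideal.Quotient.eq, hm']
  exact (Ideal.Quotient.eq).1 ha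

lemma closed {C : Type} [CommRing C] [IsLocalRing C] [IsNoetherianRing C] (I : Ideal C) (x : C)
    (h : ∀ k, x ∈ I ⊔ maximalIdeal C ^ k) : x ∈ I := by
  rw [← Ideal.Quotient.eq_zero_iff_mem]
  refine IsHausdorff.haus (inferInstance : IsHausdorff (maximalIdeal C) (C ⧸ I)) _ fun n => ?_
  rw [SModEq.zero]
  obtain ⟨u, hu, v, hv, huv⟩ := Submodule.mem_sup.1 (h n)
  have : Ideal.Quotient.mk I x = v • (1 : C ⧸ I) := by
    rw [← huv, map_add, Ideal.Quotient.eq_zero_iff_mem.2 hu, zero_add, Algebra.smul_def, mul_one]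
    rfl
  rw [this]
  exact Submodule.smul_mem_smul hv trivial

lemma hat_ker [IsNoetherianRing (Hat R)] {T : Type} [CommRing T] [IsLocalRing T]
    (g : R →+* T) (I : Ideal R) (hI : I ≤ RingHom.ker g)
    (hc : ∀ k, (maximalIdeal T ^ k).comap g ≤ I ⊔ maximalIdeal R ^ k)
    (hl : (maximalIdeal R).map g ≤ maximalIdeal T)
    (ĝ : Hat R →+* T) (h : ĝ.comp (algebraMap R (Hat R)) = g) :
    RingHom.ker ĝ = I.map (algebraMap R (Hat R)) := by
  apply le_antisymm
  · intro x hx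
    refine closed _ _ fun k => ?_
    obtain ⟨a, ha⟩ := hat_exists x k
    have h1 : ĝ (x - algebraMap R (Hat R) a) ∈ maximalIdeal T ^ k := by
      have h2 : (maximalIdeal (Hat R) ^ k).map ĝ ≤ maximalIdeal T ^ k := by
        rw [Ideal.map_pow, AdicCompletion.maximalIdeal_eq_map, Ideal.map_map, h]
        exact Ideal.pow_right_mono hl k
      exact h2 (Ideal.mem_map_of_mem _ ha)
    rw [map_sub, (RingHom.mem_ker).1 hx, zero_sub, neg_mem_iff, ← RingHom.comp_apply, h] at h1
    have h3 := Ideal.mem_map_of_mem (algebraMap R (Hat R)) (hc k h1)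
    rw [Ideal.map_sup, Ideal.map_pow, ← AdicCompletion.maximalIdeal_eq_map] at h3
    have := add_mem (mle le_sup_right ha : _ ∈ I.map (algebraMap R (Hat R)) ⊔ _) h3
    simpa using this
  · rw [Ideal.map_le_iff_le_comap]
    intro a ha
    rw [Ideal.mem_comap, RingHom.mem_ker, ← RingHom.comp_apply, h]
    exact hI ha

lemma RS_hat [IsNoetherianRing (Hat R)] (l : List R) (h : RS l) :
    RS (l.map (algebraMap R (Hat R))) := by
  refine ⟨?_, ?_⟩
  · rw [← isWeaklyRegular_iff_WR]
    exact ((isWeaklyRegular_iff_WR l).2 h.1).of_flat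
  · rw [← map_ofList, AdicCompletion.maximalIdeal_eq_map]
    exact Ideal.map_mono h.2

/-- Completion of a regular local ring is noetherian. -/
lemma hat_noeth (ys : List R) (h : RS ys) (hm : ofList ys = maximalIdeal R) :
    IsNoetherianRing (Hat R) := by
  have hN := (Pc.main (⊥ : Ideal R) bot_le (GG_bot h hm) ys hm.le (by rw [hm]; simp)).1
  set I := fun k => (⊥ : Ideal R) ⊔ maximalIdeal R ^ k with hI
  have hIk : ∀ k, I k = maximalIdeal R ^ k := fun k => bot_sup_eq _
  have hanti : Antitone I := fun i j h => sup_le_sup le_rfl (Ideal.pow_le_pow_right h)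
  obtain ⟨ĝ, hg⟩ := lift_gen (X := Pc I) (maximalIdeal (Hat R)) I (Pc.ev I)
    (fun x j k hjk a ha => Pc.ev_le hanti x hjk ha) (algebraMap R (Hat R)) (fun k a ha => by
      rw [hIk] at ha
      exact (hat_of_mem_pow a k).2 ha)
  refine isNoetherianRing_of_surjective (Pc I) (Hat R) ĝ fun x => ?_
  choose a ha using hat_exists x
  have hp : (fun k => Ideal.Quotient.mk (I k) (a k)) ∈ Pc I := by
    refine fun j k hjk => ⟨a k, ?_, rfl⟩
    rw [Ideal.Quotient.eq, hIk, ← hat_of_mem_pow, map_sub]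
    have := sub_mem (Ideal.pow_le_pow_right hjk (ha k)) (ha j)
    rwa [sub_sub_sub_cancel_left] at this
  refine ⟨⟨_, hp⟩, haus_eq (maximalIdeal (Hat R)) fun k => ?_⟩
  have h1 := hg ⟨_, hp⟩ k (a k) rfl
  have := sub_mem h1 (ha k)
  rwa [sub_sub_sub_cancel_right] at this
end hat
end CIAD


set_option linter.unusedSectionVars false
namespace CIAD
open Ideal IsLocalRing RingTheory.Sequence

lemma exists_list_of_fg {C : Type} [CommRing C] (I : Ideal C) (h : I.FG) : ∃ l, ofList l = I := by
  obtain ⟨s, rfl⟩ := h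
  exact ⟨s.toList, by simp [Ideal.ofList]⟩

lemma fg_ofList {C : Type} [CommRing C] (l : List C) : (ofList l).FG := by
  classical
  exact ⟨l.toFinset, by simp [Ideal.ofList]⟩

lemma local_le {A X : Type} [CommRing A] [IsLocalRing A] [CommRing X] [IsLocalRing X] (g : A →+* X)
    (hg : Function.Surjective g) : (maximalIdeal A).map g = maximalIdeal X := by
  have := IsLocalHom.of_surjective g hg
  rw [← maximalIdeal_comap g, Ideal.map_comap_of_surjective g hg]

section cover
variable {X Y Z : Type} [CommRing X] [CommRing Y] [CommRing Z]
  [IsLocalRing X] [IsLocalRing Y] [IsLocalRing Z]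

lemma ker_fst_fg [IsNoetherianRing Y] (u : X →+* Z) (v : Y →+* Z)
    (hu : Function.Surjective u) : (RingHom.ker (u.pullbackFst v)).FG := by
  obtain ⟨t, ht⟩ := exists_list_of_fg (RingHom.ker v) (IsNoetherian.noetherian _)
  have h1 : ∀ t : List Y, ofList t ≤ RingHom.ker v → ∃ t' : List (u.pullback v),
      t'.map (u.pullbackSnd v) = t ∧ ofList t' ≤ RingHom.ker (u.pullbackFst v) := by
    intro t
    induction t with
    | nil => intro _; exact ⟨[], rfl, by simp⟩
    | cons y t ih =>
      intro h
      rw [ofList_cons, sup_le_iff] at h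
      obtain ⟨t', h1, h2⟩ := ih h.2
      have hy : v y = 0 := (Ideal.span_singleton_le_iff_mem _).1 h.1
      refine ⟨⟨(0, y), by simpa using hy.symm⟩ :: t', by simp [← h1], ?_⟩
      rw [ofList_cons]
      exact sup_le ((Ideal.span_singleton_le_iff_mem _).2 (by simp)) h2
  obtain ⟨t', h2, h3⟩ := h1 t ht.le
  have hs := RingHom.surjective_pullbackSnd_of_surjective u v hu
  have : RingHom.ker (u.pullbackFst v) = ofList t' := by
    refine le_antisymm (fun e he => ?_) h3
    have h4 : u.pullbackSnd v e ∈ (ofList t').map (u.pullbackSnd v) := by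
      rw [map_ofList, h2, ht, ← RingHom.map_pullbackSnd_ker_pullbackFst_eq u v]
      exact Ideal.mem_map_of_mem _ he
    obtain ⟨e', he', h5⟩ := (Ideal.mem_map_iff_of_surjective _ hs).1 h4
    have h6 := h3 he'
    rw [RingHom.mem_ker] at he h6
    have : e = e' := Subtype.ext (Prod.ext (he.trans h6.symm) h5.symm)
    rwa [this]
  rw [this]
  exact fg_ofList _

lemma fg_of_map {E : Type} [CommRing E] (f : E →+* X) (hf : Function.Surjective f) (I : Ideal E)
    (h1 : (I.map f).FG) (h2 : (RingHom.ker f).FG) (h3 : RingHom.ker f ≤ I) : I.FG := by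
  obtain ⟨s, hs⟩ := exists_list_of_fg _ h1
  obtain ⟨t, ht⟩ := exists_map_list f hf s
  have : I = ofList t ⊔ RingHom.ker f := by
    have e : (ofList t).map f = I.map f := by rw [map_ofList, ht, hs]
    have := congrArg (Ideal.comap f) e
    rw [Ideal.comap_map_of_surjective' f hf, Ideal.comap_map_of_surjective' f hf,
      sup_eq_left.2 h3] at this
    exact this.symm
  rw [this]
  exact Submodule.FG.sup (fg_ofList _) h2

lemma cover_A {E : Type} [CommRing E] [IsLocalRing E] (hE : (maximalIdeal E).FG)
    [IsAdicComplete (maximalIdeal X) X] [IsAdicComplete (maximalIdeal Y) Y]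
    [IsHausdorff (maximalIdeal Z) Z]
    (u : X →+* Z) (v : Y →+* Z) (hu : Function.Surjective u) (hv : Function.Surjective v)
    (p : E →+* X) (q : E →+* Y)
    (hp : Function.Surjective p) (hq : Function.Surjective q) (hpq : u.comp p = v.comp q)
    {A : Type} [CommRing A] [IsLocalRing A] (κ : A →+* E) (hκ : Function.Surjective κ)
    (hG : GG (⊥ : Ideal A)) :
    ∃ (P : Type) (_ : CommRing P) (_ : IsNoetherianRing P) (_ : IsLocalRing P),
      (∃ zs : List P, RS zs ∧ ofList zs = maximalIdeal P) ∧
      ∃ (π : P →+* X) (ρ : P →+* Y), Function.Surjective π ∧ Function.Surjective ρ ∧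
        u.comp π = v.comp ρ := by
  have hκl := IsLocalHom.of_surjective κ hκ
  have hN : RingHom.ker κ ≤ maximalIdeal A := by
    rw [← maximalIdeal_comap κ]; exact Ideal.comap_mono bot_le
  obtain ⟨c, hcN, hGc, hNc⟩ := exists_max (RingHom.ker κ) hN hG
  obtain ⟨l, hl⟩ := exists_list_of_fg _ hE
  obtain ⟨t, ht⟩ := exists_map_list κ hκ l
  have hm : maximalIdeal A = ofList t ⊔ RingHom.ker κ := by
    rw [← Ideal.comap_map_of_surjective' κ hκ, map_ofList, ht, hl, maximalIdeal_comap]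
  have h1 := Pc.main c (hcN.trans hN) hGc t (by rw [hm]; exact le_sup_left) (by
    conv_lhs => rw [hm]
    exact sup_le (le_sup_of_le_left le_sup_right)
      (hNc.trans (sup_le_sup le_sup_left le_rfl)))
  set I := fun k => c ⊔ maximalIdeal A ^ k with hI
  obtain ⟨n1, n2, -, zs, hz, hzm⟩ := h1
  have hanti : Antitone I := fun i j h => sup_le_sup le_rfl (Ideal.pow_le_pow_right h)
  have lem : ∀ (W : Type) [CommRing W] [IsLocalRing W] [IsAdicComplete (maximalIdeal W) W]
      (w : E →+* W) (hw : Function.Surjective w),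
      ∃ π : Pc I →+* W, Function.Surjective π ∧
        ∀ x k a, Pc.ev I k x = Ideal.Quotient.mk _ a → π x - w (κ a) ∈ maximalIdeal W ^ k := by
    intro W _ _ _ w hw
    obtain ⟨π, hπ⟩ := lift_gen (X := Pc I) (maximalIdeal W) I (Pc.ev I)
      (fun x j k hjk a ha => Pc.ev_le hanti x hjk ha) (w.comp κ) (fun k => by
        refine sup_le (fun a ha => ?_) ?_
        · have : κ a = 0 := hcN ha
          simp [this]
        · rw [← Ideal.map_le_iff_le_comap, Ideal.map_pow, local_le (w.comp κ) (hw.comp hκ)])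
    refine ⟨π, fun y => ?_, fun x k a h => hπ x k a h⟩
    obtain ⟨e, rfl⟩ := hw y
    obtain ⟨a, rfl⟩ := hκ e
    exact ⟨Pc.of I a, haus_eq (maximalIdeal W) fun k => hπ _ k a rfl⟩
  obtain ⟨π, hπ, hπ'⟩ := lem X p hp
  obtain ⟨ρ, hρ, hρ'⟩ := lem Y q hq
  refine ⟨Pc I, inferInstance, n1, n2, ⟨zs, hz, hzm⟩, π, ρ, hπ, hρ, RingHom.ext fun x => ?_⟩
  refine haus_eq (maximalIdeal Z) fun k => ?_
  obtain ⟨a, ha⟩ := Pc.exists_rep x k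
  have e1 := Ideal.mem_map_of_mem u (hπ' x k a ha)
  have e2 := Ideal.mem_map_of_mem v (hρ' x k a ha)
  rw [Ideal.map_pow, local_le _ hu, map_sub] at e1
  rw [Ideal.map_pow, local_le _ hv, map_sub] at e2
  have e3 : u (p (κ a)) = v (q (κ a)) := DFunLike.congr_fun hpq (κ a)
  have := sub_mem e1 e2
  rwa [e3, sub_sub_sub_cancel_right] at this

/-- A local ring with finitely generated maximal ideal is, compatibly with maps to complete
rings, covered by a regular local ring. -/
lemma cover_E {E : Type} [CommRing E] [IsLocalRing E] (hE : (maximalIdeal E).FG)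
    [IsAdicComplete (maximalIdeal X) X] [IsAdicComplete (maximalIdeal Y) Y]
    [IsHausdorff (maximalIdeal Z) Z]
    (u : X →+* Z) (v : Y →+* Z) (hu : Function.Surjective u) (hv : Function.Surjective v)
    (p : E →+* X) (q : E →+* Y)
    (hp : Function.Surjective p) (hq : Function.Surjective q) (hpq : u.comp p = v.comp q) :
    ∃ (P : Type) (_ : CommRing P) (_ : IsNoetherianRing P) (_ : IsLocalRing P),
      (∃ zs : List P, RS zs ∧ ofList zs = maximalIdeal P) ∧
      ∃ (π : P →+* X) (ρ : P →+* Y), Function.Surjective π ∧ Function.Surjective ρ ∧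
        u.comp π = v.comp ρ := by
  let ε : MvPolynomial E ℤ →+* E := (MvPolynomial.aeval (R := ℤ) (id : E → E)).toRingHom
  have hε : Function.Surjective ε := fun e => ⟨MvPolynomial.X e, by simp [ε]⟩
  let 𝔮 := (maximalIdeal E).comap ε
  have : 𝔮.IsPrime := Ideal.comap_isPrime _ _
  let κ : Localization.AtPrime 𝔮 →+* E := IsLocalization.lift (M := 𝔮.primeCompl) (g := ε) (by
    rintro ⟨y, hy⟩
    by_contra hcon
    exact hy hcon)
  have hκ : Function.Surjective κ := fun e => by
    obtain ⟨x, rfl⟩ := hε e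
    exact ⟨algebraMap _ _ x, IsLocalization.lift_eq _ _⟩
  have hG := GG_loc 𝔮
  exact cover_A hE u v hu hv p q hp hq hpq κ hκ hG
lemma cover [IsNoetherianRing Y] (hX : (maximalIdeal X).FG)
    [IsAdicComplete (maximalIdeal X) X] [IsAdicComplete (maximalIdeal Y) Y]
    [IsHausdorff (maximalIdeal Z) Z]
    (u : X →+* Z) (v : Y →+* Z) (hu : Function.Surjective u) (hv : Function.Surjective v) :
    ∃ (P : Type) (_ : CommRing P) (_ : IsNoetherianRing P) (_ : IsLocalRing P),
      (∃ zs : List P, RS zs ∧ ofList zs = maximalIdeal P) ∧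
      ∃ (π : P →+* X) (ρ : P →+* Y), Function.Surjective π ∧ Function.Surjective ρ ∧
        u.comp π = v.comp ρ := by
  have := IsLocalHom.of_surjective v hv
  have : IsLocalRing (u.pullback v) := RingHom.isLocalRing_pullback u v
  have h1 := RingHom.surjective_pullbackFst_of_surjective u v hv
  have h2 := RingHom.surjective_pullbackSnd_of_surjective u v hu
  refine cover_E (E := u.pullback v) ?_ u v hu hv _ _ h1 h2 (RingHom.pullback_comm_sq u v)
  refine fg_of_map (u.pullbackFst v) h1 _ ?_ (ker_fst_fg u v hu) ?_
  · rwa [local_le _ h1]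
  · rw [← maximalIdeal_comap (u.pullbackFst v)]; exact Ideal.comap_mono bot_le
end cover
end CIAD


set_option linter.unusedSectionVars false
namespace CIAD
open Ideal IsLocalRing RingTheory.Sequence

lemma core {P X Y Z : Type} [CommRing P] [CommRing X] [CommRing Y] [CommRing Z]
    [IsLocalRing P] [IsLocalRing X] [IsLocalRing Y] [IsLocalRing Z]
    [IsNoetherianRing P] [IsNoetherianRing Y]
    (zs : List P) (hz : RS zs) (hzm : ofList zs = maximalIdeal P)
    (ws : List Y) (hw : RS ws) (hwm : ofList ws = maximalIdeal Y)
    (π : P →+* X) (hπ : Function.Surjective π) (ρ : P →+* Y) (hρ : Function.Surjective ρ)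
    (u : X →+* Z) (v : Y →+* Z) (hc : u.comp π = v.comp ρ)
    (fs : List Y) (hf : RS fs) (hfk : ofList fs = RingHom.ker v)
    (k : ℕ) (hFR : FR X k 1 (idealSub (RingHom.ker u))) :
    ∃ gs hs : List P, RS gs ∧ ofList gs = RingHom.ker π ∧
      RS (hs.map π) ∧ ofList (hs.map π) = RingHom.ker u := by
  have lρ := IsLocalHom.of_surjective ρ hρ
  have lπ := IsLocalHom.of_surjective π hπ
  obtain ⟨n, hn⟩ := FR_of_RS ws hw
  have k1 := key ρ hρ (maximalIdeal P) le_rfl n (by rwa [local_le ρ hρ, ← hwm])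
  obtain ⟨gs0, ys, h1, h2, -⟩ := split (RingHom.ker ρ) [] zs hz (by simp) (by
    rw [List.nil_append, hzm, ← maximalIdeal_comap ρ]; exact Ideal.comap_mono bot_le)
    (by rwa [List.nil_append, hzm])
  obtain ⟨hs0, -, h3, h4⟩ := RS_lift ρ hρ gs0 h1.prefix h2 fs hf
  have h5 : ofList (gs0 ++ hs0) = (RingHom.ker u).comap π := by
    rw [h4, hfk, RingHom.comap_ker, RingHom.comap_ker, hc]
  have k2 := key π hπ (ofList (gs0 ++ hs0)) h3.2 k (by
    rwa [h5, Ideal.map_comap_of_surjective π hπ])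
  obtain ⟨gs, hs, h6, h7, h8⟩ := split (RingHom.ker π) [] (gs0 ++ hs0) h3 (by simp) (by
    rw [List.nil_append, h5]; exact Ideal.comap_mono bot_le)
    (by rwa [List.nil_append])
  rw [List.nil_append] at h8
  have h9 : ofList (hs.map π) = RingHom.ker u := by
    have e := congrArg (Ideal.map π) (h8.trans h5)
    rw [Ideal.map_comap_of_surjective π hπ, ofList_append, Ideal.map_sup, h7, map_ofList] at e
    rw [← e, (Ideal.map_eq_bot_iff_le_ker π).2 le_rfl, bot_sup_eq]
  have h10 := (WR_append _ _ _).1 h6.1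
  rw [bot_sup_eq, h7, WR_ker π hπ] at h10
  refine ⟨gs, hs, h6.prefix, h7, ⟨h10.2, ?_⟩, h9⟩
  rw [← map_ofList, ← local_le π hπ]
  refine Ideal.map_mono (le_trans ?_ h6.2)
  rw [ofList_append]; exact le_sup_right

section
variable {R T : Type} [CommRing R] [IsLocalRing R] [IsNoetherianRing R]
  [CommRing T] [IsLocalRing T] 

lemma hat_of_surj [IsAdicComplete (maximalIdeal T) T] (g : R →+* T) (hg : Function.Surjective g) :
    ∃ ĝ : Hat R →+* T, Function.Surjective ĝ ∧
      (IsNoetherianRing (Hat R) → RingHom.ker ĝ = (RingHom.ker g).map (algebraMap R (Hat R))) := by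
  have := IsLocalHom.of_surjective g hg
  obtain ⟨ĝ, h⟩ := hat_lift g
  refine ⟨ĝ, hat_surj g (local_le g hg) ((residue_surjective).comp hg) ĝ h, fun _ => ?_⟩
  refine hat_ker g _ le_rfl (fun k => ?_) (local_le g hg).le ĝ h
  rw [← local_le g hg, ← Ideal.map_pow, Ideal.comap_map_of_surjective' g hg, sup_comm]

lemma hat_of_surj' [IsNoetherianRing T] (g : R →+* T) (hg : Function.Surjective g) :
    ∃ ĝ : Hat R →+* Hat T, Function.Surjective ĝ ∧
      (IsNoetherianRing (Hat R) → RingHom.ker ĝ = (RingHom.ker g).map (algebraMap R (Hat R))) := by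
  have := IsLocalHom.of_surjective g hg
  let G := (algebraMap T (Hat T)).comp g
  obtain ⟨ĝ, h⟩ := hat_lift G
  have hm : (maximalIdeal R).map G = maximalIdeal (Hat T) := by
    rw [← Ideal.map_map, local_le g hg, AdicCompletion.maximalIdeal_eq_map]
  refine ⟨ĝ, hat_surj G hm (fun x => ?_) ĝ h, fun _ => ?_⟩
  · obtain ⟨t, rfl⟩ := residue_surjective x
    obtain ⟨a, ha⟩ := hat_exists t 1
    obtain ⟨b, rfl⟩ := hg a
    refine ⟨b, ?_⟩
    rw [pow_one] at ha
    exact (Ideal.Quotient.eq.2 ha).symm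
  · refine hat_ker G _ (fun a ha => ?_) (fun k a ha => ?_) hm.le ĝ h
    · rw [RingHom.mem_ker] at *
      simp [G, ha]
    · have : g a ∈ maximalIdeal T ^ k := (hat_of_mem_pow (g a) k).1 ha
      rw [← local_le g hg, ← Ideal.map_pow, ← Ideal.mem_comap,
        Ideal.comap_map_of_surjective' g hg, sup_comm] at this
      exact this
end

theorem forward (R S : Type) [CommRing R] [CommRing S]
    [IsNoetherianRing R] [IsNoetherianRing S] [IsLocalRing R] [IsLocalRing S]
    (φ : R →+* S) (hφs : Function.Surjective φ)
    (hpd : letI := φ.toAlgebra; HasFiniteProjectiveDimension R S)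
    (hS : IsCompleteIntersectionRing S) :
    IsCompleteIntersectionRing R ∧ φ.IsCompleteIntersection := by
  obtain ⟨Q, _, _, _, ⟨ys, hy, hym⟩, f, hf, fs, hfs, hfk⟩ := hS
  have hy : RS ys := (CIAD.isRegular_iff ys).1 hy
  have hfs : RS fs := (CIAD.isRegular_iff fs).1 hfs
  have nQ : IsNoetherianRing (Hat Q) := hat_noeth ys hy hym
  obtain ⟨v, hv, hvk⟩ := hat_of_surj f hf
  have hvk := hvk nQ
  obtain ⟨u, hu, huk⟩ := hat_of_surj' φ hφs
  have hfg : (maximalIdeal (Hat R)).FG := by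
    rw [AdicCompletion.maximalIdeal_eq_map]
    exact ((maximalIdeal R).fg_of_isNoetherianRing).map _
  obtain ⟨P, _, _, _, ⟨zs, hz, hzm⟩, π, ρ, hπ, hρ, hc⟩ := cover hfg u v hu hv
  have nR : IsNoetherianRing (Hat R) := isNoetherianRing_of_surjective P _ π hπ
  have huk := huk nR
  have hφl := IsLocalHom.of_surjective φ hφs
  obtain ⟨k, hk⟩ : ∃ k, FR R k 1 (idealSub (RingHom.ker φ)) := by
    letI := φ.toAlgebra
    obtain ⟨n, hn⟩ := pd_of_finite hpd
    have e : LinearMap.ker (Algebra.linearMap R S) = RingHom.ker φ := rfl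
    have := FR_of_pd_quot n (Algebra.linearMap R S) hφs (by
      rw [e, ← maximalIdeal_comap φ]; exact Ideal.comap_mono bot_le) hn
    rwa [e] at this
  have hk' := FR_baseChange_ideal (R := Hat R) k _ hk
  rw [← huk] at hk'
  obtain ⟨gs, hs, h1, h2, h3, h4⟩ := core zs hz hzm (ys.map (algebraMap Q (Hat Q))) (RS_hat ys hy)
    (by rw [← map_ofList, hym, AdicCompletion.maximalIdeal_eq_map]) π hπ ρ hρ u v hc
    (fs.map (algebraMap Q (Hat Q))) (RS_hat fs hfs) (by rw [← map_ofList, hfk, hvk]) k hk'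
  refine ⟨⟨P, _, ‹_›, ‹_›, ⟨zs, (CIAD.isRegular_iff zs).2 hz, hzm⟩, π, hπ, gs,
    (CIAD.isRegular_iff gs).2 h1, h2⟩, ?_⟩
  have : Module.FaithfullyFlat R (Hat R) := Module.FaithfullyFlat.of_flat_of_isLocalHom
  obtain ⟨rs, h5, h6⟩ := descent (C := R) (D := Hat R) AdicCompletion.maximalIdeal_eq_map.symm
    (RingHom.ker φ) [] (hs.map π) h3 (by rw [← huk, ← h4]; rfl) (by simp)
  exact ⟨rs, (CIAD.isRegular_iff rs).2 h5, h6⟩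

theorem backward (R S : Type) [CommRing R] [CommRing S]
    [IsNoetherianRing R] [IsNoetherianRing S] [IsLocalRing R] [IsLocalRing S]
    (φ : R →+* S) (hφs : Function.Surjective φ)
    (hR : IsCompleteIntersectionRing R) (hφ : φ.IsCompleteIntersection) :
    IsCompleteIntersectionRing S := by
  obtain ⟨Q, _, _, _, hQ, f, hf, fs, hfs, hfk⟩ := hR
  obtain ⟨rs, hr, hrk⟩ := hφ
  have hfs : RS fs := (CIAD.isRegular_iff fs).1 hfs
  have hr : RS rs := (CIAD.isRegular_iff rs).1 hr
  obtain ⟨u, hu, huk⟩ := hat_of_surj' φ hφs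
  have nR : IsNoetherianRing (Hat R) := isNoetherianRing_of_surjective Q _ f hf
  obtain ⟨hs, -, h1, h2⟩ := RS_lift f hf fs hfs hfk (rs.map (algebraMap R (Hat R))) (RS_hat rs hr)
  refine ⟨Q, _, ‹_›, ‹_›, hQ, u.comp f, hu.comp hf, fs ++ hs, (CIAD.isRegular_iff _).2 h1, ?_⟩
  rw [h2, ← map_ofList, hrk, ← huk nR, RingHom.comap_ker]
end CIAD


theorem complete_intersection_ascent_descent
    (R S : Type) [CommRing R] [CommRing S]
    [IsNoetherianRing R] [IsNoetherianRing S]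
    [IsLocalRing R] [IsLocalRing S]
    (φ : R →+* S) (hφs : Function.Surjective φ) (hφl : IsLocalHom φ)
    (hpd : letI := φ.toAlgebra; HasFiniteProjectiveDimension R S) :
    (IsCompleteIntersectionRing S →
      IsCompleteIntersectionRing R ∧ φ.IsCompleteIntersection) ∧
    (IsCompleteIntersectionRing R ∧ φ.IsCompleteIntersection →
      IsCompleteIntersectionRing S) := by
  exact ⟨fun h => CIAD.forward R S φ hφs hpd h, fun h => CIAD.backward R S φ hφs h.1 h.2⟩
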